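/- Let π be a prior density on ℝ^p such that m_π(z; v_x) < ∞ for all z and R_KL(μ, p̂_π) < ∞ for all μ. Set v_w = v_x v_y/(v_x + v_y) (so v_w < v_x). Then for every μ ∈ ℝ^p, R_KL(μ, p̂_{π_U}) − R_KL(μ, p̂_π) = (1/2) ∫_{v_w}^{v_x} v^{−2} [R_Q^v(μ, μ̂_MLE) − R_Q^v(μ, μ̂_π)] dv, where π_U ≡ 1 is the uniform prior density. -/

import Mathlib

open MeasureTheory Filter
open scoped ENNReal Classical

noncomputable def gauss (p : ℕ) (v : ℝ) (μ z : EuclideanSpace ℝ (Fin p)) : ℝ :=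
  (2 * Real.pi * v) ^ (-(p : ℝ) / 2) * Real.exp (-‖z - μ‖ ^ 2 / (2 * v))

/-- Kullback–Leibler loss of the density estimate `g` for the true density `gauss p vy μ`. -/
noncomputable def klLoss (p : ℕ) (vy : ℝ) (μ : EuclideanSpace ℝ (Fin p))
    (g : EuclideanSpace ℝ (Fin p) → ℝ) : ℝ≥0∞ :=
  if (∀ᵐ y, 0 < g y) ∧
      Integrable (fun y => gauss p vy μ y * Real.log (gauss p vy μ y / g y)) then
    ENNReal.ofReal (∫ y, gauss p vy μ y * Real.log (gauss p vy μ y / g y))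
  else ⊤

noncomputable def klRisk (p : ℕ) (vx vy : ℝ) (μ : EuclideanSpace ℝ (Fin p))
    (phat : EuclideanSpace ℝ (Fin p) → EuclideanSpace ℝ (Fin p) → ℝ) : ℝ≥0∞ :=
  ∫⁻ x, klLoss p vy μ (phat x) * ENNReal.ofReal (gauss p vx μ x)

def IsProc (p : ℕ) (phat : EuclideanSpace ℝ (Fin p) → EuclideanSpace ℝ (Fin p) → ℝ) : Prop :=
  ∀ x, (∀ᵐ y, 0 ≤ phat x y) ∧ (∫ y, phat x y) = 1

def Admissible (p : ℕ) (vx vy : ℝ)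
    (phat : EuclideanSpace ℝ (Fin p) → EuclideanSpace ℝ (Fin p) → ℝ) : Prop :=
  IsProc p phat ∧
    ¬ ∃ q, IsProc p q ∧ (∀ μ, klRisk p vx vy μ q ≤ klRisk p vx vy μ phat) ∧
      ∃ μ, klRisk p vx vy μ q < klRisk p vx vy μ phat

noncomputable def marg (p : ℕ) (v : ℝ) (π : EuclideanSpace ℝ (Fin p) → ℝ)
    (z : EuclideanSpace ℝ (Fin p)) : ℝ :=
  ∫ μ, gauss p v μ z * π μ

noncomputable def bayesRule (p : ℕ) (vx vy : ℝ) (π : EuclideanSpace ℝ (Fin p) → ℝ)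
    (x y : EuclideanSpace ℝ (Fin p)) : ℝ :=
  (∫ μ, gauss p vx μ x * gauss p vy μ y * π μ) / marg p vx π x

noncomputable def postMean (p : ℕ) (v : ℝ) (π : EuclideanSpace ℝ (Fin p) → ℝ)
    (z : EuclideanSpace ℝ (Fin p)) : EuclideanSpace ℝ (Fin p) :=
  (marg p v π z)⁻¹ • ∫ μ, (gauss p v μ z * π μ) • μ

noncomputable def qRisk (p : ℕ) (v : ℝ) (μ : EuclideanSpace ℝ (Fin p))
    (est : EuclideanSpace ℝ (Fin p) → EuclideanSpace ℝ (Fin p)) : ℝ :=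
  ∫ z, gauss p v μ z * ‖est z - μ‖ ^ 2

noncomputable def bKL (p : ℕ) (vx vy : ℝ) (ρ : EuclideanSpace ℝ (Fin p) → ℝ)
    (phat : EuclideanSpace ℝ (Fin p) → EuclideanSpace ℝ (Fin p) → ℝ) : ℝ≥0∞ :=
  ∫⁻ μ, klRisk p vx vy μ phat * ENNReal.ofReal (ρ μ)

noncomputable def bQ (p : ℕ) (v : ℝ) (ρ : EuclideanSpace ℝ (Fin p) → ℝ)
    (est : EuclideanSpace ℝ (Fin p) → EuclideanSpace ℝ (Fin p)) : ℝ :=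
  ∫ μ, ρ μ * qRisk p v μ est

noncomputable def margGrad (p : ℕ) (v : ℝ) (π : EuclideanSpace ℝ (Fin p) → ℝ)
    (z : EuclideanSpace ℝ (Fin p)) : EuclideanSpace ℝ (Fin p) :=
  ∫ μ, gauss p v μ z • gradient π μ

/-- The uniform bound `C = (2πv_y)^(-p/2)` on the normal density. -/
noncomputable def Cbound (p : ℕ) (vy : ℝ) : ℝ :=
  (2 * Real.pi * vy) ^ (-(p : ℝ) / 2)

/-- The Bayes rule associated with a (possibly improper) prior measure `M`. -/
noncomputable def bayesM (p : ℕ) (vx vy : ℝ) (M : Measure (EuclideanSpace ℝ (Fin p)))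
    (x y : EuclideanSpace ℝ (Fin p)) : ℝ :=
  (∫ μ, gauss p vx μ x * gauss p vy μ y ∂M) / ∫ μ, gauss p vx μ x ∂M

section PartA

variable {p : ℕ}

lemma gauss_pos {v : ℝ} (hv : 0 < v) (μ z : EuclideanSpace ℝ (Fin p)) : 0 < gauss p v μ z := by
  unfold gauss; positivity

lemma gauss_symm (v : ℝ) (μ z : EuclideanSpace ℝ (Fin p)) : gauss p v μ z = gauss p v z μ := by
  unfold gauss; rw [norm_sub_rev]

lemma gauss_continuous (v : ℝ) :
    Continuous (fun q : EuclideanSpace ℝ (Fin p) × EuclideanSpace ℝ (Fin p) =>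
      gauss p v q.1 q.2) := by
  unfold gauss; fun_prop

lemma gauss_continuous_right (v : ℝ) (μ : EuclideanSpace ℝ (Fin p)) :
    Continuous (fun z => gauss p v μ z) := by
  unfold gauss; fun_prop

lemma gauss_continuous_left (v : ℝ) (z : EuclideanSpace ℝ (Fin p)) :
    Continuous (fun μ => gauss p v μ z) := by
  unfold gauss; fun_prop

lemma gauss_zero (v : ℝ) (μ z : EuclideanSpace ℝ (Fin p)) :
    gauss p v μ z = gauss p v 0 (z - μ) := by
  unfold gauss; simp

lemma integrable_exp_neg_sq {b : ℝ} (hb : 0 < b) :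
    Integrable (fun z : EuclideanSpace ℝ (Fin p) => Real.exp (-b * ‖z‖ ^ 2)) := by
  have h := GaussianFourier.integrable_cexp_neg_mul_sq_norm_add
    (V := EuclideanSpace ℝ (Fin p)) (b := (b : ℂ)) (by simpa using hb) 0 0
  have h2 := h.re
  refine h2.congr (Eventually.of_forall fun z => ?_)
  simp only [zero_mul, add_zero]
  have : (-(b:ℂ) * (‖z‖:ℂ) ^ 2) = ((-b * ‖z‖^2 : ℝ) : ℂ) := by push_cast; ring
  rw [this, ← Complex.ofReal_exp]
  exact Complex.ofReal_re _

lemma gauss_integrable {v : ℝ} (hv : 0 < v) (μ : EuclideanSpace ℝ (Fin p)) :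
    Integrable (fun z => gauss p v μ z) := by
  have h : Integrable (fun z : EuclideanSpace ℝ (Fin p) => gauss p v 0 z) := by
    unfold gauss
    refine Integrable.const_mul ?_ _
    refine (integrable_exp_neg_sq (p := p) (b := 1 / (2 * v)) (by positivity)).congr
      (Eventually.of_forall fun z => ?_)
    simp only [sub_zero]
    congr 1; field_simp
  have h2 := h.comp_sub_right μ
  refine h2.congr (Eventually.of_forall fun z => ?_)
  exact (gauss_zero v μ z).symm

lemma gauss_integral {v : ℝ} (hv : 0 < v) (μ : EuclideanSpace ℝ (Fin p)) :
    ∫ z, gauss p v μ z = 1 := by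
  simp_rw [gauss_zero v μ]
  rw [integral_sub_right_eq_self (fun z => gauss p v 0 z) μ]
  unfold gauss
  rw [integral_const_mul]
  have := GaussianFourier.integral_rexp_neg_mul_sq_norm (V := EuclideanSpace ℝ (Fin p))
    (b := 1 / (2 * v)) (by positivity)
  have h2 : ∀ z : EuclideanSpace ℝ (Fin p),
      Real.exp (-‖z - 0‖ ^ 2 / (2 * v)) = Real.exp (-(1 / (2 * v)) * ‖z‖ ^ 2) := by
    intro z; simp only [sub_zero]; congr 1; field_simp
  simp_rw [h2, this]
  rw [finrank_euclideanSpace, Fintype.card_fin]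
  have h3 : Real.pi / (1 / (2 * v)) = 2 * Real.pi * v := by field_simp
  rw [h3, ← Real.rpow_add (by positivity)]
  rw [neg_div, neg_add_cancel, Real.rpow_zero]

/-- The normal law as a measure. -/
noncomputable def nm (p : ℕ) (v : ℝ) (μ : EuclideanSpace ℝ (Fin p)) :
    Measure (EuclideanSpace ℝ (Fin p)) :=
  volume.withDensity (fun z => ENNReal.ofReal (gauss p v μ z))

lemma nm_meas (v : ℝ) (μ : EuclideanSpace ℝ (Fin p)) :
    Measurable (fun z => ENNReal.ofReal (gauss p v μ z)) :=
  (gauss_continuous_right v μ).measurable.ennreal_ofReal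

instance nm_sfinite (v : ℝ) (μ : EuclideanSpace ℝ (Fin p)) : SFinite (nm p v μ) := by
  unfold nm; infer_instance

lemma nm_prob {v : ℝ} (hv : 0 < v) (μ : EuclideanSpace ℝ (Fin p)) :
    IsProbabilityMeasure (nm p v μ) := by
  constructor
  unfold nm
  rw [withDensity_apply _ MeasurableSet.univ, Measure.restrict_univ,
    ← ofReal_integral_eq_lintegral_ofReal (gauss_integrable hv μ)
      (Eventually.of_forall fun z => (gauss_pos hv μ z).le), gauss_integral hv]
  simp

lemma nm_integral {F : Type*} [NormedAddCommGroup F] [NormedSpace ℝ F] {v : ℝ} (hv : 0 < v)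
    (μ : EuclideanSpace ℝ (Fin p)) (f : EuclideanSpace ℝ (Fin p) → F) :
    ∫ z, f z ∂(nm p v μ) = ∫ z, gauss p v μ z • f z := by
  unfold nm
  rw [integral_withDensity_eq_integral_toReal_smul (nm_meas v μ) (by simp)]
  refine integral_congr_ae (Eventually.of_forall fun z => ?_)
  simp only
  rw [ENNReal.toReal_ofReal (gauss_pos hv μ z).le]

lemma nm_integrable {F : Type*} [NormedAddCommGroup F] [NormedSpace ℝ F] {v : ℝ} (hv : 0 < v)
    (μ : EuclideanSpace ℝ (Fin p)) (f : EuclideanSpace ℝ (Fin p) → F) :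
    Integrable f (nm p v μ) ↔ Integrable (fun z => gauss p v μ z • f z) := by
  unfold nm
  rw [integrable_withDensity_iff_integrable_smul' (nm_meas v μ) (by simp)]
  refine integrable_congr (Eventually.of_forall fun z => ?_)
  simp only
  rw [ENNReal.toReal_ofReal (gauss_pos hv μ z).le]

lemma nm_ac {v : ℝ} (μ : EuclideanSpace ℝ (Fin p)) : nm p v μ ≪ volume :=
  withDensity_absolutelyContinuous _ _

lemma gauss_scale {v : ℝ} (hv : 0 < v) (μ ξ : EuclideanSpace ℝ (Fin p)) :
    gauss p v μ (μ + √v • ξ) = |(√v ^ p)⁻¹| * gauss p 1 0 ξ := by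
  unfold gauss
  have h1 : ‖μ + √v • ξ - μ‖ ^ 2 = v * ‖ξ‖ ^ 2 := by
    rw [add_sub_cancel_left, norm_smul, mul_pow, Real.norm_eq_abs, sq_abs, Real.sq_sqrt hv.le]
  have h2 : |(√v ^ p)⁻¹| = v ^ (-(p:ℝ) / 2) := by
    rw [abs_of_pos (by positivity), Real.sqrt_eq_rpow, ← Real.rpow_natCast, ← Real.rpow_mul hv.le,
      ← Real.rpow_neg hv.le]
    congr 1; ring
  rw [h1, h2, mul_one, Real.mul_rpow (by positivity) hv.le, sub_zero]
  have h3 : -(v * ‖ξ‖ ^ 2) / (2 * v) = -‖ξ‖ ^ 2 / 2 := by field_simp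
  rw [h3]; ring

lemma nm_scale_integral {F : Type*} [NormedAddCommGroup F] [NormedSpace ℝ F] {v : ℝ} (hv : 0 < v)
    (μ : EuclideanSpace ℝ (Fin p)) (f : EuclideanSpace ℝ (Fin p) → F) :
    ∫ z, f z ∂(nm p v μ) = ∫ ξ, f (μ + √v • ξ) ∂(nm p 1 0) := by
  rw [nm_integral hv, nm_integral one_pos,
    ← integral_add_left_eq_self (fun z => gauss p v μ z • f z) μ]
  have h := Measure.integral_comp_smul (volume : Measure (EuclideanSpace ℝ (Fin p)))
    (fun z => gauss p v μ (μ + z) • f (μ + z)) √v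
  simp only [gauss_scale hv, finrank_euclideanSpace, Fintype.card_fin, mul_smul] at h
  rw [integral_smul] at h
  have h0 : |(√v ^ p)⁻¹| ≠ 0 := by
    have : 0 < √v := Real.sqrt_pos.2 hv
    positivity
  exact (smul_right_injective F h0 h).symm

lemma nm_scale_integrable {F : Type*} [NormedAddCommGroup F] [NormedSpace ℝ F] {v : ℝ} (hv : 0 < v)
    (μ : EuclideanSpace ℝ (Fin p)) (f : EuclideanSpace ℝ (Fin p) → F) :
    Integrable f (nm p v μ) ↔ Integrable (fun ξ => f (μ + √v • ξ)) (nm p 1 0) := by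
  have hs : 0 < √v := Real.sqrt_pos.2 hv
  rw [nm_integrable hv, nm_integrable one_pos,
    ← (measurePreserving_add_left volume μ).integrable_comp_emb (measurableEmbedding_addLeft μ),
    ← integrable_comp_smul_iff volume _ hs.ne']
  have h0 : |(√v ^ p)⁻¹| ≠ 0 := by
    have : 0 < √v := Real.sqrt_pos.2 hv
    positivity
  simp only [Function.comp_def, gauss_scale hv, mul_smul]
  exact integrable_smul_iff (IsUnit.mk0 _ h0).unit.ne_zero _

lemma sq_integrable : Integrable (fun ξ : EuclideanSpace ℝ (Fin p) => ‖ξ‖ ^ 2) (nm p 1 0) := by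
  rw [nm_integrable one_pos]
  unfold gauss
  simp only [smul_eq_mul, mul_assoc, sub_zero]
  refine Integrable.const_mul ?_ _
  refine Integrable.mono' ((integrable_exp_neg_sq (p := p) (b := 1 / 4) (by norm_num)).const_mul 4)
    (by fun_prop) (Eventually.of_forall fun z => ?_)
  rw [Real.norm_of_nonneg (by positivity)]
  have h1 : Real.exp (-‖z‖ ^ 2 / (2 * 1)) =
      Real.exp (-(1/4) * ‖z‖ ^ 2) * Real.exp (-(1/4) * ‖z‖ ^ 2) := by
    rw [← Real.exp_add]; congr 1; ring
  have h2 : ‖z‖ ^ 2 * Real.exp (-(1/4) * ‖z‖ ^ 2) ≤ 4 := by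
    have h3 := Real.add_one_le_exp (1/4 * ‖z‖^2)
    have h4 : Real.exp (1/4 * ‖z‖^2) * Real.exp (-(1/4) * ‖z‖ ^ 2) = 1 := by
      rw [← Real.exp_add]; simp
    have h5 : 0 < Real.exp (-(1/4) * ‖z‖ ^ 2) := Real.exp_pos _
    nlinarith
  have h5 : 0 < Real.exp (-(1/4) * ‖z‖ ^ 2) := Real.exp_pos _
  rw [h1]
  nlinarith

lemma quad_integrable (C : ℝ) :
    Integrable (fun ξ : EuclideanSpace ℝ (Fin p) => C * (1 + ‖ξ‖ ^ 2)) (nm p 1 0) := by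
  have := nm_prob one_pos (0 : EuclideanSpace ℝ (Fin p))
  exact ((integrable_const 1).add sq_integrable).const_mul C

lemma integrable_of_quad {F : Type*} [NormedAddCommGroup F]
    {f : EuclideanSpace ℝ (Fin p) → F} (C : ℝ)
    (hf : AEStronglyMeasurable f (nm p 1 0)) (h : ∀ ξ, ‖f ξ‖ ≤ C * (1 + ‖ξ‖ ^ 2)) :
    Integrable f (nm p 1 0) :=
  (quad_integrable C).mono' hf (Eventually.of_forall h)

lemma gauss_lineDeriv (i : Fin p) (ξ : EuclideanSpace ℝ (Fin p)) :
    HasLineDerivAt ℝ (fun z => gauss p 1 0 z) (-(ξ i) * gauss p 1 0 ξ) ξ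
      (EuclideanSpace.single i 1) := by
  unfold HasLineDerivAt gauss
  simp only [sub_zero, mul_one]
  have h : ∀ t : ℝ, ‖ξ + t • EuclideanSpace.single i (1:ℝ)‖ ^ 2
      = ‖ξ‖ ^ 2 + 2 * t * ξ i + t ^ 2 := by
    intro t
    rw [norm_add_sq_real, inner_smul_right, norm_smul, EuclideanSpace.inner_single_right]
    simp; ring
  simp_rw [h]
  have h1 : HasDerivAt (fun t : ℝ => -(‖ξ‖ ^ 2 + 2 * t * ξ i + t ^ 2) / 2) (-(ξ i)) 0 := by
    have h2 : HasDerivAt (fun t : ℝ => (‖ξ‖ ^ 2 + 2 * t * ξ i + t ^ 2)) (2 * 1 * ξ i + 2 * 0) 0 := by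
      have h3 := (((hasDerivAt_id (0:ℝ)).const_mul 2).mul_const (ξ i)).const_add (‖ξ‖^2)
      have h4 := (hasDerivAt_pow 2 (0:ℝ))
      exact (h3.add h4).congr_deriv (by simp)
    exact (h2.neg.div_const 2).congr_deriv (by ring)
  have h5 := h1.exp.const_mul ((2 * Real.pi) ^ (-(p:ℝ) / 2))
  refine h5.congr_deriv ?_
  simp only [mul_zero, zero_mul, add_zero, ne_eq, OfNat.ofNat_ne_zero, not_false_eq_true, zero_pow]
  ring

lemma stein (i : Fin p) (f f' : EuclideanSpace ℝ (Fin p) → ℝ)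
    (hf : ∀ ξ, HasLineDerivAt ℝ f (f' ξ) ξ (EuclideanSpace.single i 1))
    (h1 : Integrable f (nm p 1 0)) (h2 : Integrable f' (nm p 1 0))
    (h3 : Integrable (fun ξ => ξ i * f ξ) (nm p 1 0)) :
    ∫ ξ, ξ i * f ξ ∂(nm p 1 0) = ∫ ξ, f' ξ ∂(nm p 1 0) := by
  rw [nm_integrable one_pos] at h1 h2 h3
  have h := integral_bilinear_hasLineDerivAt_right_eq_neg_left_of_integrable
    (μ := (volume : Measure (EuclideanSpace ℝ (Fin p))))
    (f := f) (f' := f') (g := fun z => gauss p 1 0 z)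
    (g' := fun ξ => -(ξ i) * gauss p 1 0 ξ) (v := EuclideanSpace.single i 1)
    (B := ContinuousLinearMap.mul ℝ ℝ)
    (by refine h2.congr (Eventually.of_forall fun z => ?_); simp [mul_comm])
    (by refine h3.neg.congr (Eventually.of_forall fun z => ?_); simp; ring)
    (by refine h1.congr (Eventually.of_forall fun z => ?_); simp [mul_comm])
    (fun x _ => hf x) (fun x _ => gauss_lineDeriv i x)
  rw [nm_integral one_pos, nm_integral one_pos]
  simp only [ContinuousLinearMap.mul_apply'] at h
  have e1 : ∫ z : EuclideanSpace ℝ (Fin p), gauss p 1 0 z • (z i * f z)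
      = - ∫ z : EuclideanSpace ℝ (Fin p), f z * (-(z i) * gauss p 1 0 z) := by
    rw [← integral_neg]; congr 1; ext z; simp; ring
  rw [e1, h, neg_neg]
  congr 1; ext z; simp [mul_comm]

lemma coord_sq_le (ξ : EuclideanSpace ℝ (Fin p)) (i : Fin p) : ξ i ^ 2 ≤ ‖ξ‖ ^ 2 := by
  rw [EuclideanSpace.real_norm_sq_eq]
  exact Finset.single_le_sum (f := fun i => ξ i ^ 2) (fun j _ => sq_nonneg _) (Finset.mem_univ i)

lemma sq_integral : ∫ ξ : EuclideanSpace ℝ (Fin p), ‖ξ‖ ^ 2 ∂(nm p 1 0) = p := by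
  have := nm_prob one_pos (0 : EuclideanSpace ℝ (Fin p))
  simp_rw [EuclideanSpace.real_norm_sq_eq]
  have hi : ∀ i : Fin p, Integrable (fun ξ : EuclideanSpace ℝ (Fin p) => ξ i * ξ i) (nm p 1 0) := by
    intro i
    refine integrable_of_quad 1 (by fun_prop) fun ξ => ?_
    rw [Real.norm_of_nonneg (mul_self_nonneg _)]
    nlinarith [coord_sq_le ξ i]
  rw [integral_finsetSum]
  · have : ∀ i : Fin p, ∫ ξ : EuclideanSpace ℝ (Fin p), ξ i ^ 2 ∂(nm p 1 0) = 1 := by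
      intro i
      have := stein i (fun ξ => ξ i) (fun _ => 1) (fun ξ => ?_) ?_ (integrable_const _) (hi i)
      · simp_rw [sq, this]; simp
      · unfold HasLineDerivAt
        simp only [PiLp.add_apply, PiLp.smul_apply, EuclideanSpace.single_apply, if_true, smul_eq_mul,
          mul_one]
        exact (hasDerivAt_id (0:ℝ)).const_add _
      · refine integrable_of_quad 1 (by fun_prop) fun ξ => ?_
        rw [Real.norm_eq_abs, abs_le]
        constructor <;> nlinarith [coord_sq_le ξ i, sq_nonneg (ξ i - 1), sq_nonneg (ξ i + 1)]
    simp [this]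
  · intro i _
    simpa [sq] using hi i

end PartA

section PartB

variable {p : ℕ}

/-- Exponential tilt. -/
noncomputable def ee (s : ℝ) (ξ θ : EuclideanSpace ℝ (Fin p)) : ℝ :=
  Real.exp (s * inner ℝ ξ θ - s ^ 2 * ‖θ‖ ^ 2 / 2)

noncomputable def MM (ν : Measure (EuclideanSpace ℝ (Fin p))) (s : ℝ)
    (ξ : EuclideanSpace ℝ (Fin p)) : ℝ := ∫ θ, ee s ξ θ ∂ν

noncomputable def GG (ν : Measure (EuclideanSpace ℝ (Fin p))) (s : ℝ)
    (ξ : EuclideanSpace ℝ (Fin p)) : ℝ := Real.log (MM ν s ξ)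

noncomputable def NN (ν : Measure (EuclideanSpace ℝ (Fin p))) (s : ℝ)
    (ξ : EuclideanSpace ℝ (Fin p)) : EuclideanSpace ℝ (Fin p) := ∫ θ, ee s ξ θ • θ ∂ν

noncomputable def TT (ν : Measure (EuclideanSpace ℝ (Fin p))) (s : ℝ)
    (ξ : EuclideanSpace ℝ (Fin p)) : EuclideanSpace ℝ (Fin p) := (MM ν s ξ)⁻¹ • NN ν s ξ

noncomputable def QQ (ν : Measure (EuclideanSpace ℝ (Fin p))) (s : ℝ)
    (ξ : EuclideanSpace ℝ (Fin p)) : ℝ := ∫ θ, ee s ξ θ * ‖θ‖ ^ 2 ∂ν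

noncomputable def QQi (ν : Measure (EuclideanSpace ℝ (Fin p))) (i : Fin p) (s : ℝ)
    (ξ : EuclideanSpace ℝ (Fin p)) : ℝ := ∫ θ, ee s ξ θ * (θ i) ^ 2 ∂ν

lemma ee_pos (s : ℝ) (ξ θ : EuclideanSpace ℝ (Fin p)) : 0 < ee s ξ θ := Real.exp_pos _

lemma ee_cont (s : ℝ) (ξ : EuclideanSpace ℝ (Fin p)) : Continuous (ee s ξ) := by
  unfold ee; fun_prop

lemma ee_cont2 (s : ℝ) :
    Continuous (fun q : EuclideanSpace ℝ (Fin p) × EuclideanSpace ℝ (Fin p) => ee s q.1 q.2) := by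
  unfold ee; fun_prop

lemma inner_young (ξ θ : EuclideanSpace ℝ (Fin p)) {c : ℝ} (hc : 0 < c) (t : ℝ) :
    t * inner ℝ ξ θ ≤ c * ‖θ‖ ^ 2 + t ^ 2 * ‖ξ‖ ^ 2 / (4 * c) := by
  have h : 0 ≤ ‖(2 * c) • θ - t • ξ‖ ^ 2 := by positivity
  rw [norm_sub_sq_real, norm_smul, norm_smul, inner_smul_left, inner_smul_right,
    real_inner_comm, mul_pow, mul_pow, Real.norm_eq_abs, Real.norm_eq_abs, sq_abs, sq_abs] at h
  simp only [conj_trivial] at h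
  have h2 : c * ‖θ‖ ^ 2 + t ^ 2 * ‖ξ‖ ^ 2 / (4 * c) - t * inner ℝ ξ θ
    = ((2 * c) ^ 2 * ‖θ‖ ^ 2 - 2 * (2 * c * (t * inner ℝ ξ θ)) + t ^ 2 * ‖ξ‖ ^ 2) / (4 * c) := by
    field_simp; ring
  have h3 : 0 ≤ c * ‖θ‖ ^ 2 + t ^ 2 * ‖ξ‖ ^ 2 / (4 * c) - t * inner ℝ ξ θ := by
    rw [h2]; exact div_nonneg h (by positivity)
  linarith

lemma K1 {s0 s : ℝ} (h0 : 0 < s0) (hs : s0 ≤ s) (ξ θ : EuclideanSpace ℝ (Fin p)) :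
    ee s ξ θ ≤ Real.exp (‖ξ‖ ^ 2 / 2) * ee s0 ξ θ := by
  unfold ee
  rw [← Real.exp_add]
  apply Real.exp_le_exp.2
  rcases hs.eq_or_lt with rfl | hs
  · have : 0 ≤ ‖ξ‖ ^ 2 / 2 := by positivity
    linarith
  have hd : 0 < s ^ 2 - s0 ^ 2 := by nlinarith
  have h := inner_young ξ θ (c := (s ^ 2 - s0 ^ 2) / 2) (by linarith) (s - s0)
  have h2 : (s - s0) ^ 2 * ‖ξ‖ ^ 2 / (4 * ((s ^ 2 - s0 ^ 2) / 2)) ≤ ‖ξ‖ ^ 2 / 2 := by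
    rw [div_le_div_iff₀ (by linarith) (by norm_num)]
    have : (s - s0) ^ 2 ≤ s ^ 2 - s0 ^ 2 := by nlinarith
    have h4 : 0 ≤ ‖ξ‖ ^ 2 := by positivity
    nlinarith
  linarith

lemma K2 {s0 s1 s2 s : ℝ} (h0 : 0 < s0) (h01 : s0 < s1) (hs1 : s1 ≤ s) (hs2 : s ≤ s2)
    (ξ θ : EuclideanSpace ℝ (Fin p)) :
    Real.exp ((s1 ^ 2 - s0 ^ 2) / 4 * ‖θ‖ ^ 2) * ee s ξ θ ≤
      Real.exp (s2 ^ 2 / (s1 ^ 2 - s0 ^ 2) * ‖ξ‖ ^ 2) * Real.exp (-(s0 ^ 2 * ‖θ‖ ^ 2 / 2)) := by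
  unfold ee
  rw [← Real.exp_add, ← Real.exp_add]
  apply Real.exp_le_exp.2
  have hd : 0 < s1 ^ 2 - s0 ^ 2 := by nlinarith
  have h := inner_young ξ θ (c := (s1 ^ 2 - s0 ^ 2) / 4) (by linarith) s
  have h2 : s ^ 2 * ‖ξ‖ ^ 2 / (4 * ((s1 ^ 2 - s0 ^ 2) / 4))
      ≤ s2 ^ 2 / (s1 ^ 2 - s0 ^ 2) * ‖ξ‖ ^ 2 := by
    rw [div_mul_eq_mul_div, mul_div_cancel₀ _ (by norm_num : (4:ℝ) ≠ 0)]
    gcongr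
    linarith
  have h3 : s1 ^ 2 * ‖θ‖ ^ 2 ≤ s ^ 2 * ‖θ‖ ^ 2 := by
    gcongr
    linarith
  linarith

lemma K2_one {s0 s1 s2 s : ℝ} (h0 : 0 < s0) (h01 : s0 < s1) (hs1 : s1 ≤ s) (hs2 : s ≤ s2)
    (ξ θ : EuclideanSpace ℝ (Fin p)) :
    ee s ξ θ ≤
      Real.exp (s2 ^ 2 / (s1 ^ 2 - s0 ^ 2) * ‖ξ‖ ^ 2) * Real.exp (-(s0 ^ 2 * ‖θ‖ ^ 2 / 2)) := by
  have hd : 0 < s1 ^ 2 - s0 ^ 2 := by nlinarith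
  refine le_trans ?_ (K2 h0 h01 hs1 hs2 ξ θ)
  refine le_mul_of_one_le_left (ee_pos _ _ _).le (Real.one_le_exp (by positivity))

lemma K2_sq {s0 s1 s2 s : ℝ} (h0 : 0 < s0) (h01 : s0 < s1) (hs1 : s1 ≤ s) (hs2 : s ≤ s2)
    (ξ θ : EuclideanSpace ℝ (Fin p)) :
    ee s ξ θ * ‖θ‖ ^ 2 ≤ (4 / (s1 ^ 2 - s0 ^ 2)) *
      (Real.exp (s2 ^ 2 / (s1 ^ 2 - s0 ^ 2) * ‖ξ‖ ^ 2) * Real.exp (-(s0 ^ 2 * ‖θ‖ ^ 2 / 2))) := by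
  have hd : 0 < s1 ^ 2 - s0 ^ 2 := by nlinarith
  refine le_trans ?_ (mul_le_mul_of_nonneg_left (K2 h0 h01 hs1 hs2 ξ θ) (by positivity))
  have h := Real.add_one_le_exp ((s1 ^ 2 - s0 ^ 2) / 4 * ‖θ‖ ^ 2)
  have e := ee_pos s ξ θ
  have h2 : ‖θ‖ ^ 2 ≤ 4 / (s1 ^ 2 - s0 ^ 2) * Real.exp ((s1 ^ 2 - s0 ^ 2) / 4 * ‖θ‖ ^ 2) := by
    rw [div_mul_eq_mul_div, le_div_iff₀ hd]
    linarith
  calc ee s ξ θ * ‖θ‖ ^ 2 ≤ ee s ξ θ * (4 / (s1 ^ 2 - s0 ^ 2) *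
        Real.exp ((s1 ^ 2 - s0 ^ 2) / 4 * ‖θ‖ ^ 2)) := by gcongr
    _ = _ := by ring

variable {ν : Measure (EuclideanSpace ℝ (Fin p))} {s0 : ℝ}

lemma ee_int (h0 : 0 < s0) (hw : Integrable (fun θ => Real.exp (-(s0 ^ 2 * ‖θ‖ ^ 2 / 2))) ν)
    {s : ℝ} (hs : s0 < s) (ξ : EuclideanSpace ℝ (Fin p)) : Integrable (ee s ξ) ν := by
  refine (hw.const_mul (Real.exp (s ^ 2 / (s ^ 2 - s0 ^ 2) * ‖ξ‖ ^ 2))).mono'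
    (ee_cont s ξ).aestronglyMeasurable (Eventually.of_forall fun θ => ?_)
  rw [Real.norm_of_nonneg (ee_pos _ _ _).le]
  exact K2_one h0 hs le_rfl le_rfl ξ θ

lemma ee_sq_int (h0 : 0 < s0) (hw : Integrable (fun θ => Real.exp (-(s0 ^ 2 * ‖θ‖ ^ 2 / 2))) ν)
    {s : ℝ} (hs : s0 < s) (ξ : EuclideanSpace ℝ (Fin p)) :
    Integrable (fun θ => ee s ξ θ * ‖θ‖ ^ 2) ν := by
  have hc := ee_cont s ξ
  refine ((hw.const_mul (Real.exp (s ^ 2 / (s ^ 2 - s0 ^ 2) * ‖ξ‖ ^ 2))).const_mul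
    (4 / (s ^ 2 - s0 ^ 2))).mono' (by fun_prop) (Eventually.of_forall fun θ => ?_)
  rw [Real.norm_of_nonneg (mul_nonneg (ee_pos _ _ _).le (by positivity))]
  exact K2_sq h0 hs le_rfl le_rfl ξ θ

lemma ee_vec_int (h0 : 0 < s0) (hw : Integrable (fun θ => Real.exp (-(s0 ^ 2 * ‖θ‖ ^ 2 / 2))) ν)
    {s : ℝ} (hs : s0 < s) (ξ : EuclideanSpace ℝ (Fin p)) :
    Integrable (fun θ => ee s ξ θ • θ) ν := by
  have hc := ee_cont s ξ
  refine ((ee_int h0 hw hs ξ).add (ee_sq_int h0 hw hs ξ)).mono' (by fun_prop)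
    (Eventually.of_forall fun θ => ?_)
  rw [norm_smul, Real.norm_of_nonneg (ee_pos _ _ _).le, Pi.add_apply]
  have := ee_pos s ξ θ
  nlinarith [sq_nonneg (‖θ‖ - 1), norm_nonneg θ]

lemma ee_coord_int (h0 : 0 < s0) (hw : Integrable (fun θ => Real.exp (-(s0 ^ 2 * ‖θ‖ ^ 2 / 2))) ν)
    {s : ℝ} (hs : s0 < s) (ξ : EuclideanSpace ℝ (Fin p)) (i : Fin p) :
    Integrable (fun θ => ee s ξ θ * θ i) ν :=
  (EuclideanSpace.proj (𝕜 := ℝ) i).integrable_comp (ee_vec_int h0 hw hs ξ)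

lemma NN_coord (h0 : 0 < s0) (hw : Integrable (fun θ => Real.exp (-(s0 ^ 2 * ‖θ‖ ^ 2 / 2))) ν)
    {s : ℝ} (hs : s0 < s) (ξ : EuclideanSpace ℝ (Fin p)) (i : Fin p) :
    NN ν s ξ i = ∫ θ, ee s ξ θ * θ i ∂ν :=
  ((EuclideanSpace.proj (𝕜 := ℝ) i).integral_comp_comm (ee_vec_int h0 hw hs ξ)).symm

lemma ee_coord_sq_int (h0 : 0 < s0)
    (hw : Integrable (fun θ => Real.exp (-(s0 ^ 2 * ‖θ‖ ^ 2 / 2))) ν)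
    {s : ℝ} (hs : s0 < s) (ξ : EuclideanSpace ℝ (Fin p)) (i : Fin p) :
    Integrable (fun θ => ee s ξ θ * (θ i) ^ 2) ν := by
  have hc := ee_cont s ξ
  refine (ee_sq_int h0 hw hs ξ).mono' (by fun_prop) (Eventually.of_forall fun θ => ?_)
  rw [Real.norm_of_nonneg (mul_nonneg (ee_pos _ _ _).le (by positivity))]
  exact mul_le_mul_of_nonneg_left (coord_sq_le θ i) (ee_pos _ _ _).le

lemma QQ_sum (h0 : 0 < s0) (hw : Integrable (fun θ => Real.exp (-(s0 ^ 2 * ‖θ‖ ^ 2 / 2))) ν)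
    {s : ℝ} (hs : s0 < s) (ξ : EuclideanSpace ℝ (Fin p)) :
    QQ ν s ξ = ∑ i, QQi ν i s ξ := by
  unfold QQ QQi
  rw [← integral_finsetSum _ fun i _ => ee_coord_sq_int h0 hw hs ξ i]
  simp_rw [EuclideanSpace.real_norm_sq_eq, Finset.mul_sum]

/-- Lower bound for the log-marginal. -/
lemma lower (hw : Integrable (fun θ => Real.exp (-(s0 ^ 2 * ‖θ‖ ^ 2 / 2))) ν) (hν : ν ≠ 0)
    (s2 : ℝ) : ∃ c : ℝ, 0 ≤ c ∧ ∀ s, 0 ≤ s → s ≤ s2 → ∀ ξ, Integrable (ee s ξ) ν →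
      0 < MM ν s ξ ∧ -(c * (1 + ‖ξ‖ ^ 2)) ≤ GG ν s ξ := by
  obtain ⟨n, hn⟩ : ∃ n : ℕ, ν (Metric.closedBall 0 n) ≠ 0 := by
    by_contra! h
    apply hν
    rw [← Measure.measure_univ_eq_zero, ← Metric.iUnion_closedBall_nat (0 : EuclideanSpace ℝ (Fin p))]
    exact measure_iUnion_null h
  have hfin : ν (Metric.closedBall 0 n) < ⊤ := by
    have h1 := hw.measure_norm_ge_lt_top (ε := Real.exp (-(s0 ^ 2 * (n:ℝ) ^ 2 / 2)))
      (Real.exp_pos _)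
    refine lt_of_le_of_lt (measure_mono fun θ hθ => ?_) h1
    simp only [Set.mem_ofPred_eq, Real.norm_eq_abs, Real.abs_exp]
    apply Real.exp_le_exp.2
    have : ‖θ‖ ≤ n := by simpa using hθ
    gcongr
  set a := ν.real (Metric.closedBall 0 n) with ha
  have hapos : 0 < a := ENNReal.toReal_pos hn hfin.ne
  refine ⟨|s2| * n + s2 ^ 2 * n ^ 2 / 2 + |Real.log a|, by positivity, fun s hs hs2 ξ hi => ?_⟩
  have key : Real.exp (-(s * ‖ξ‖ * n + s ^ 2 * n ^ 2 / 2)) * a ≤ MM ν s ξ := by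
    unfold MM
    have h1 : ∫ θ in Metric.closedBall 0 n, Real.exp (-(s * ‖ξ‖ * n + s ^ 2 * n ^ 2 / 2)) ∂ν
        ≤ ∫ θ in Metric.closedBall 0 n, ee s ξ θ ∂ν := by
      refine setIntegral_mono_on (integrableOn_const hfin.ne) hi.integrableOn
        Metric.isClosed_closedBall.measurableSet fun θ hθ => ?_
      apply Real.exp_le_exp.2
      have hθ : ‖θ‖ ≤ n := by simpa using hθ
      have h2 := (abs_le.1 (abs_real_inner_le_norm ξ θ)).1
      have h3 : s * (-(‖ξ‖ * n)) ≤ s * inner ℝ ξ θ := by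
        refine mul_le_mul_of_nonneg_left (le_trans ?_ h2) hs
        have : ‖ξ‖ * ‖θ‖ ≤ ‖ξ‖ * n := by gcongr
        linarith
      have h4 : s ^ 2 * ‖θ‖ ^ 2 ≤ s ^ 2 * n ^ 2 := by gcongr
      linarith
    rw [setIntegral_const, smul_eq_mul, mul_comm] at h1
    exact h1.trans (setIntegral_le_integral hi (Eventually.of_forall fun θ => (ee_pos _ _ _).le))
  have hpos : 0 < Real.exp (-(s * ‖ξ‖ * n + s ^ 2 * n ^ 2 / 2)) * a := by positivity
  refine ⟨hpos.trans_le key, ?_⟩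
  have h5 := Real.log_le_log hpos key
  rw [Real.log_mul (Real.exp_pos _).ne' hapos.ne', Real.log_exp] at h5
  refine le_trans ?_ h5
  have h6 := neg_abs_le (Real.log a)
  have hs2' : s ≤ |s2| := hs2.trans (le_abs_self _)
  have h7 : s * ‖ξ‖ * n ≤ |s2| * n * (1 + ‖ξ‖ ^ 2) := by
    have : ‖ξ‖ ≤ 1 + ‖ξ‖ ^ 2 := by nlinarith [sq_nonneg (‖ξ‖ - 1), norm_nonneg ξ]
    calc s * ‖ξ‖ * n ≤ |s2| * (1 + ‖ξ‖ ^ 2) * n := by gcongr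
      _ = _ := by ring
  have h8 : s ^ 2 * n ^ 2 ≤ s2 ^ 2 * n ^ 2 := by gcongr
  have h9 : 0 ≤ (s2 ^ 2 * n ^ 2 / 2 + |Real.log a|) * ‖ξ‖ ^ 2 := by positivity
  nlinarith

lemma growth (h0 : 0 < s0) (hw : Integrable (fun θ => Real.exp (-(s0 ^ 2 * ‖θ‖ ^ 2 / 2))) ν)
    (hν : ν ≠ 0) {s1 s2 : ℝ} (h01 : s0 < s1) : ∃ C : ℝ, 0 ≤ C ∧ ∀ s, s1 ≤ s → s ≤ s2 → ∀ ξ,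
      0 < MM ν s ξ ∧ |GG ν s ξ| ≤ C * (1 + ‖ξ‖ ^ 2) ∧
      QQ ν s ξ ≤ C * (1 + ‖ξ‖ ^ 2) * MM ν s ξ := by
  obtain ⟨c, hc, hl⟩ := lower hw hν s2
  have hd : 0 < s1 ^ 2 - s0 ^ 2 := by nlinarith
  set κ := s2 ^ 2 / (s1 ^ 2 - s0 ^ 2) with hκ
  have hκ0 : 0 ≤ κ := by positivity
  set δ := (s1 ^ 2 - s0 ^ 2) / 4 with hδ
  have hδ0 : 0 < δ := by positivity
  set W := ∫ θ, Real.exp (-(s0 ^ 2 * ‖θ‖ ^ 2 / 2)) ∂ν with hW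
  set A := κ + |Real.log W| + c with hA
  have hA0 : 0 ≤ A := by positivity
  refine ⟨max A (A / δ), le_max_of_le_left hA0, fun s hs1 hs2 ξ => ?_⟩
  have hi := ee_int h0 hw (h01.trans_le hs1) ξ
  obtain ⟨hM, hG⟩ := hl s (by linarith) hs2 ξ hi
  have hMW : MM ν s ξ ≤ Real.exp (κ * ‖ξ‖ ^ 2) * W := by
    unfold MM
    rw [hW, ← integral_const_mul]
    exact integral_mono hi (hw.const_mul _) fun θ => K2_one h0 h01 hs1 hs2 ξ θ
  have hW0 : 0 < W := by
    by_contra h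
    have : Real.exp (κ * ‖ξ‖ ^ 2) * W ≤ 0 :=
      mul_nonpos_of_nonneg_of_nonpos (Real.exp_pos _).le (not_lt.1 h)
    linarith
  have hGu : GG ν s ξ ≤ κ * ‖ξ‖ ^ 2 + Real.log W := by
    have := Real.log_le_log hM hMW
    rwa [Real.log_mul (Real.exp_pos _).ne' hW0.ne', Real.log_exp] at this
  have hq : 0 ≤ ‖ξ‖ ^ 2 := by positivity
  have hq1 : 0 ≤ 1 + ‖ξ‖ ^ 2 := by positivity
  have hlw := le_abs_self (Real.log W)
  have hlw' := abs_nonneg (Real.log W)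
  have hup : κ * ‖ξ‖ ^ 2 + Real.log W ≤ (κ + |Real.log W|) * (1 + ‖ξ‖ ^ 2) := by nlinarith
  have hx : κ * ‖ξ‖ ^ 2 + Real.log W - GG ν s ξ ≤ A * (1 + ‖ξ‖ ^ 2) := by rw [hA]; nlinarith
  refine ⟨hM, ?_, ?_⟩
  · have : |GG ν s ξ| ≤ A * (1 + ‖ξ‖ ^ 2) := by
      rw [abs_le]
      constructor
      · refine le_trans ?_ hG
        have : c * (1 + ‖ξ‖ ^ 2) ≤ A * (1 + ‖ξ‖ ^ 2) := by
          gcongr; rw [hA]; linarith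
        linarith
      · refine (hGu.trans hup).trans ?_
        gcongr; rw [hA]; linarith
    exact this.trans (by gcongr; exact le_max_left _ _)
  · set d := κ * ‖ξ‖ ^ 2 + Real.log W - GG ν s ξ with hdd
    have hpt : ∀ θ, δ * (ee s ξ θ * ‖θ‖ ^ 2) ≤
        Real.exp (-d) * (Real.exp (κ * ‖ξ‖ ^ 2) * Real.exp (-(s0 ^ 2 * ‖θ‖ ^ 2 / 2)))
          + (d - 1) * ee s ξ θ := by
      intro θ
      have h1 := Real.add_one_le_exp (δ * ‖θ‖ ^ 2 - d)
      rw [sub_eq_add_neg, Real.exp_add] at h1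
      have h2 := mul_le_mul_of_nonneg_left (K2 h0 h01 hs1 hs2 ξ θ) (Real.exp_pos (-d)).le
      have h3 := mul_le_mul_of_nonneg_left h1 (ee_pos s ξ θ).le
      rw [← hδ, ← hκ] at h2
      nlinarith
    have h4 := integral_mono ((ee_sq_int h0 hw (h01.trans_le hs1) ξ).const_mul δ)
      (((hw.const_mul _).const_mul _).add (hi.const_mul _)) hpt
    simp only [Pi.add_apply] at h4
    rw [integral_add ((hw.const_mul _).const_mul _) (hi.const_mul _), integral_const_mul,
      integral_const_mul, integral_const_mul, integral_const_mul] at h4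
    change δ * QQ ν s ξ ≤ Real.exp (-d) * (Real.exp (κ * ‖ξ‖ ^ 2) * W) + (d - 1) * MM ν s ξ at h4
    have h5 : Real.exp (-d) * (Real.exp (κ * ‖ξ‖ ^ 2) * W) = MM ν s ξ := by
      rw [hdd, neg_sub, Real.exp_sub, Real.exp_add, Real.exp_log hW0]
      unfold GG
      rw [Real.exp_log hM]
      field_simp
    rw [h5] at h4
    have h6 : δ * QQ ν s ξ ≤ d * MM ν s ξ := by linarith
    have h7 : QQ ν s ξ ≤ d / δ * MM ν s ξ := by
      rw [div_mul_eq_mul_div, le_div_iff₀ hδ0]; linarith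
    refine h7.trans ?_
    refine mul_le_mul_of_nonneg_right ?_ hM.le
    calc d / δ ≤ A * (1 + ‖ξ‖ ^ 2) / δ := by gcongr
      _ = A / δ * (1 + ‖ξ‖ ^ 2) := by ring
      _ ≤ _ := by gcongr; exact le_max_right _ _

lemma TT_sq_le (h0 : 0 < s0) (hw : Integrable (fun θ => Real.exp (-(s0 ^ 2 * ‖θ‖ ^ 2 / 2))) ν)
    {s : ℝ} (hs : s0 < s) (ξ : EuclideanSpace ℝ (Fin p)) (hM : 0 < MM ν s ξ) :
    ‖TT ν s ξ‖ ^ 2 * MM ν s ξ ≤ QQ ν s ξ := by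
  set T := TT ν s ξ with hT
  have hN : NN ν s ξ = MM ν s ξ • T := by
    rw [hT]; unfold TT; rw [smul_smul, mul_inv_cancel₀ hM.ne', one_smul]
  have h1 : 0 ≤ ∫ θ, (ee s ξ θ * ‖θ‖ ^ 2 - 2 * inner ℝ T (ee s ξ θ • θ) + ‖T‖ ^ 2 * ee s ξ θ) ∂ν := by
    refine integral_nonneg fun θ => ?_
    have : 0 ≤ ee s ξ θ * ‖θ - T‖ ^ 2 := mul_nonneg (ee_pos _ _ _).le (by positivity)
    rw [norm_sub_sq_real] at this
    simp only [Pi.zero_apply]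
    rw [inner_smul_right, real_inner_comm]
    nlinarith
  have hi1 := ee_sq_int h0 hw hs ξ
  have hi2 := ((ee_vec_int h0 hw hs ξ).const_inner (𝕜 := ℝ) T).const_mul 2
  have hi3 := (ee_int h0 hw hs ξ).const_mul (‖T‖ ^ 2)
  have hi12 : Integrable (fun θ => ee s ξ θ * ‖θ‖ ^ 2 - 2 * inner ℝ T (ee s ξ θ • θ)) ν :=
    hi1.sub hi2
  rw [integral_add hi12 hi3, integral_sub hi1 hi2, integral_const_mul, integral_const_mul,
    integral_inner (ee_vec_int h0 hw hs ξ)] at h1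
  change 0 ≤ QQ ν s ξ - 2 * inner ℝ T (NN ν s ξ) + ‖T‖ ^ 2 * MM ν s ξ at h1
  rw [hN, inner_smul_right, real_inner_self_eq_norm_sq] at h1
  linarith

end PartB

section PartC

variable {p : ℕ} {ν : Measure (EuclideanSpace ℝ (Fin p))} {s0 : ℝ}

lemma ee_deriv_s (s : ℝ) (ξ θ : EuclideanSpace ℝ (Fin p)) :
    HasDerivAt (fun s => ee s ξ θ) (ee s ξ θ * (inner ℝ ξ θ - s * ‖θ‖ ^ 2)) s := by
  unfold ee
  have h1 := ((hasDerivAt_id s).mul_const (inner ℝ ξ θ))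
  have h2 := (((hasDerivAt_pow 2 s).mul_const (‖θ‖ ^ 2)).div_const 2)
  refine (h1.sub h2).exp.congr_deriv ?_
  simp only [Pi.sub_apply, id]
  congr 1
  simp; ring

lemma MM_deriv_s (h0 : 0 < s0) (hw : Integrable (fun θ => Real.exp (-(s0 ^ 2 * ‖θ‖ ^ 2 / 2))) ν)
    {s : ℝ} (hs : s0 < s) (ξ : EuclideanSpace ℝ (Fin p)) :
    HasDerivAt (fun s => MM ν s ξ) (inner ℝ ξ (NN ν s ξ) - s * QQ ν s ξ) s := by
  set s1 := (s0 + s) / 2 with hs1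
  set s2 := s + 1 with hs2
  have h01 : s0 < s1 := by rw [hs1]; linarith
  have hd : 0 < s1 ^ 2 - s0 ^ 2 := by nlinarith
  have hcs : ∀ s, Continuous (ee s ξ) := fun s => ee_cont s ξ
  set K := Real.exp (s2 ^ 2 / (s1 ^ 2 - s0 ^ 2) * ‖ξ‖ ^ 2) with hK
  have h := hasDerivAt_integral_of_dominated_loc_of_deriv_le (μ := ν) (x₀ := s)
    (s := Set.Ioo s1 s2) (F := fun s θ => ee s ξ θ)
    (F' := fun s θ => ee s ξ θ * (inner ℝ ξ θ - s * ‖θ‖ ^ 2))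
    (bound := fun θ => (‖ξ‖ ^ 2 / 2) * (K * Real.exp (-(s0 ^ 2 * ‖θ‖ ^ 2 / 2)))
      + (1 / 2 + s2) * ((4 / (s1 ^ 2 - s0 ^ 2)) * (K * Real.exp (-(s0 ^ 2 * ‖θ‖ ^ 2 / 2)))))
    (Ioo_mem_nhds (by rw [hs1]; linarith) (by rw [hs2]; linarith))
    (Eventually.of_forall fun s => (hcs s).aestronglyMeasurable)
    (ee_int h0 hw hs ξ) (by have := hcs s; fun_prop)
    (Eventually.of_forall fun θ t ht => ?_)
    (((hw.const_mul _).const_mul _).add (((hw.const_mul _).const_mul _).const_mul _))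
    (Eventually.of_forall fun θ t ht => ee_deriv_s t ξ θ)
  · refine h.2.congr_deriv ?_
    have e : ∀ θ, ee s ξ θ * (inner ℝ ξ θ - s * ‖θ‖ ^ 2)
        = inner ℝ ξ (ee s ξ θ • θ) - s * (ee s ξ θ * ‖θ‖ ^ 2) := by
      intro θ; rw [inner_smul_right]; ring
    have e' := integral_congr_ae (μ := ν) (Eventually.of_forall e)
    refine Eq.trans e' ?_
    rw [integral_sub ((ee_vec_int h0 hw hs ξ).const_inner (𝕜 := ℝ) ξ)
      ((ee_sq_int h0 hw hs ξ).const_mul s), integral_const_mul,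
      integral_inner (ee_vec_int h0 hw hs ξ)]
    rfl
  · have e := ee_pos t ξ θ
    have k1 := K2_one h0 h01 ht.1.le ht.2.le ξ θ
    have k2 := K2_sq h0 h01 ht.1.le ht.2.le ξ θ
    rw [← hK] at k1 k2
    rw [norm_mul, Real.norm_of_nonneg e.le, Real.norm_eq_abs]
    have ht0 : 0 < t := by linarith [ht.1]
    have h1 : |inner ℝ ξ θ - t * ‖θ‖ ^ 2| ≤ ‖ξ‖ ^ 2 / 2 + (1 / 2 + s2) * ‖θ‖ ^ 2 := by
      have a1 := abs_real_inner_le_norm ξ θ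
      have a2 : |inner ℝ ξ θ - t * ‖θ‖ ^ 2| ≤ |inner ℝ ξ θ| + t * ‖θ‖ ^ 2 := by
        refine (abs_sub _ _).trans ?_
        rw [abs_of_nonneg (by positivity : 0 ≤ t * ‖θ‖ ^ 2)]
      have a3 : t * ‖θ‖ ^ 2 ≤ s2 * ‖θ‖ ^ 2 := by gcongr; exact ht.2.le
      nlinarith [sq_nonneg (‖ξ‖ - ‖θ‖)]
    have hs20 : 0 < 1 / 2 + s2 := by rw [hs2]; linarith
    calc ee t ξ θ * |inner ℝ ξ θ - t * ‖θ‖ ^ 2|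
        ≤ ee t ξ θ * (‖ξ‖ ^ 2 / 2 + (1 / 2 + s2) * ‖θ‖ ^ 2) := by gcongr
      _ = (‖ξ‖ ^ 2 / 2) * ee t ξ θ + (1 / 2 + s2) * (ee t ξ θ * ‖θ‖ ^ 2) := by ring
      _ ≤ _ := by gcongr

lemma ee_line (s : ℝ) (ξ θ : EuclideanSpace ℝ (Fin p)) (i : Fin p) (t : ℝ) :
    HasDerivAt (fun t : ℝ => ee s (ξ + t • EuclideanSpace.single i (1:ℝ)) θ)
      (ee s (ξ + t • EuclideanSpace.single i (1:ℝ)) θ * (s * θ i)) t := by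
  unfold ee
  have h : ∀ t : ℝ, s * inner ℝ (ξ + t • EuclideanSpace.single i (1:ℝ)) θ - s ^ 2 * ‖θ‖ ^ 2 / 2
      = t * (s * θ i) + (s * inner ℝ ξ θ - s ^ 2 * ‖θ‖ ^ 2 / 2) := by
    intro t
    rw [inner_add_left, inner_smul_left, EuclideanSpace.inner_single_left]
    simp; ring
  simp_rw [h]
  refine (((hasDerivAt_id t).mul_const (s * θ i)).add_const _).exp.congr_deriv ?_
  simp

lemma line_norm_le (ξ : EuclideanSpace ℝ (Fin p)) (i : Fin p) {t : ℝ} (ht : t ∈ Set.Ioo (-1:ℝ) 1) :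
    ‖ξ + t • EuclideanSpace.single i (1:ℝ)‖ ^ 2 ≤ (‖ξ‖ + 1) ^ 2 := by
  have : ‖ξ + t • EuclideanSpace.single i (1:ℝ)‖ ≤ ‖ξ‖ + 1 := by
    refine (norm_add_le _ _).trans ?_
    gcongr
    rw [norm_smul]
    simp [abs_le, ht.1.le, ht.2.le]
  gcongr

lemma MM_line (h0 : 0 < s0) (hw : Integrable (fun θ => Real.exp (-(s0 ^ 2 * ‖θ‖ ^ 2 / 2))) ν)
    {s : ℝ} (hs : s0 < s) (ξ : EuclideanSpace ℝ (Fin p)) (i : Fin p) :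
    HasLineDerivAt ℝ (fun ξ => MM ν s ξ) (s * NN ν s ξ i) ξ (EuclideanSpace.single i 1) := by
  have hd : 0 < s ^ 2 - s0 ^ 2 := by nlinarith
  have hcs : ∀ ξ : EuclideanSpace ℝ (Fin p), Continuous (ee s ξ) := fun ξ => ee_cont s ξ
  have hsp : 0 < s := h0.trans hs
  set K := Real.exp (s ^ 2 / (s ^ 2 - s0 ^ 2) * (‖ξ‖ + 1) ^ 2) with hK
  unfold HasLineDerivAt
  have h := hasDerivAt_integral_of_dominated_loc_of_deriv_le (μ := ν) (x₀ := (0:ℝ))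
    (s := Set.Ioo (-1) 1) (F := fun t θ => ee s (ξ + t • EuclideanSpace.single i (1:ℝ)) θ)
    (F' := fun t θ => ee s (ξ + t • EuclideanSpace.single i (1:ℝ)) θ * (s * θ i))
    (bound := fun θ => s * ((K * Real.exp (-(s0 ^ 2 * ‖θ‖ ^ 2 / 2)))
      + ((4 / (s ^ 2 - s0 ^ 2)) * (K * Real.exp (-(s0 ^ 2 * ‖θ‖ ^ 2 / 2))))))
    (Ioo_mem_nhds (by norm_num) (by norm_num))
    (Eventually.of_forall fun t => (hcs _).aestronglyMeasurable)
    (ee_int h0 hw hs _)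
    (by have := hcs (ξ + (0:ℝ) • EuclideanSpace.single i (1:ℝ)); fun_prop)
    (Eventually.of_forall fun θ t ht => ?_)
    (((hw.const_mul _).add ((hw.const_mul _).const_mul _)).const_mul _)
    (Eventually.of_forall fun θ t ht => ee_line s ξ θ i t)
  · refine h.2.congr_deriv ?_
    rw [NN_coord h0 hw hs, ← integral_const_mul, zero_smul, add_zero]
    congr 1; ext θ; ring
  · have e := ee_pos s (ξ + t • EuclideanSpace.single i (1:ℝ)) θ
    have hb := line_norm_le ξ i ht
    have hle : Real.exp (s ^ 2 / (s ^ 2 - s0 ^ 2) * ‖ξ + t • EuclideanSpace.single i (1:ℝ)‖ ^ 2) ≤ K := by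
      apply Real.exp_le_exp.2
      gcongr
    have k1 := K2_one h0 hs le_rfl le_rfl (ξ + t • EuclideanSpace.single i (1:ℝ)) θ
    have k2 := K2_sq h0 hs le_rfl le_rfl (ξ + t • EuclideanSpace.single i (1:ℝ)) θ
    have k1' := k1.trans (mul_le_mul_of_nonneg_right hle (Real.exp_pos _).le)
    have k2' := k2.trans (mul_le_mul_of_nonneg_left
      (mul_le_mul_of_nonneg_right hle (Real.exp_pos _).le) (by positivity))
    rw [norm_mul, norm_mul, Real.norm_of_nonneg e.le, Real.norm_of_nonneg hsp.le, Real.norm_eq_abs]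
    have h1 : |θ i| ≤ 1 + ‖θ‖ ^ 2 := by
      rw [abs_le]
      constructor <;> nlinarith [coord_sq_le θ i, sq_nonneg (θ i - 1), sq_nonneg (θ i + 1)]
    set a := ee s (ξ + t • EuclideanSpace.single i (1:ℝ)) θ
    calc a * (s * |θ i|) ≤ a * (s * (1 + ‖θ‖ ^ 2)) := by gcongr
      _ = s * (a + a * ‖θ‖ ^ 2) := by ring
      _ ≤ _ := by gcongr

lemma NN_line (h0 : 0 < s0) (hw : Integrable (fun θ => Real.exp (-(s0 ^ 2 * ‖θ‖ ^ 2 / 2))) ν)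
    {s : ℝ} (hs : s0 < s) (ξ : EuclideanSpace ℝ (Fin p)) (i : Fin p) :
    HasLineDerivAt ℝ (fun ξ => NN ν s ξ i) (s * QQi ν i s ξ) ξ (EuclideanSpace.single i 1) := by
  have hd : 0 < s ^ 2 - s0 ^ 2 := by nlinarith
  have hcs : ∀ ξ : EuclideanSpace ℝ (Fin p), Continuous (ee s ξ) := fun ξ => ee_cont s ξ
  have hsp : 0 < s := h0.trans hs
  set K := Real.exp (s ^ 2 / (s ^ 2 - s0 ^ 2) * (‖ξ‖ + 1) ^ 2) with hK
  unfold HasLineDerivAt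
  simp_rw [NN_coord h0 hw hs]
  have h := hasDerivAt_integral_of_dominated_loc_of_deriv_le (μ := ν) (x₀ := (0:ℝ))
    (s := Set.Ioo (-1) 1) (F := fun t θ => ee s (ξ + t • EuclideanSpace.single i (1:ℝ)) θ * θ i)
    (F' := fun t θ => ee s (ξ + t • EuclideanSpace.single i (1:ℝ)) θ * (s * θ i) * θ i)
    (bound := fun θ => s *
      ((4 / (s ^ 2 - s0 ^ 2)) * (K * Real.exp (-(s0 ^ 2 * ‖θ‖ ^ 2 / 2)))))
    (Ioo_mem_nhds (by norm_num) (by norm_num))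
    (Eventually.of_forall fun t => by
      have := hcs (ξ + t • EuclideanSpace.single i (1:ℝ)); fun_prop)
    (ee_coord_int h0 hw hs _ i)
    (by have := hcs (ξ + (0:ℝ) • EuclideanSpace.single i (1:ℝ)); fun_prop)
    (Eventually.of_forall fun θ t ht => ?_)
    (((hw.const_mul _).const_mul _).const_mul _)
    (Eventually.of_forall fun θ t ht => (ee_line s ξ θ i t).mul_const _)
  · refine h.2.congr_deriv ?_
    unfold QQi
    rw [← integral_const_mul, zero_smul, add_zero]
    congr 1; ext θ; ring
  · have e := ee_pos s (ξ + t • EuclideanSpace.single i (1:ℝ)) θ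
    have hb := line_norm_le ξ i ht
    have hle : Real.exp (s ^ 2 / (s ^ 2 - s0 ^ 2) * ‖ξ + t • EuclideanSpace.single i (1:ℝ)‖ ^ 2) ≤ K := by
      apply Real.exp_le_exp.2
      gcongr
    have k2 := K2_sq h0 hs le_rfl le_rfl (ξ + t • EuclideanSpace.single i (1:ℝ)) θ
    have k2' := k2.trans (mul_le_mul_of_nonneg_left
      (mul_le_mul_of_nonneg_right hle (Real.exp_pos _).le) (by positivity))
    set a := ee s (ξ + t • EuclideanSpace.single i (1:ℝ)) θ
    have e1 : a * (s * θ i) * θ i = s * (a * θ i ^ 2) := by ring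
    rw [e1, Real.norm_of_nonneg (by positivity)]
    have h1 := coord_sq_le θ i
    calc s * (a * θ i ^ 2) ≤ s * (a * ‖θ‖ ^ 2) := by gcongr
      _ ≤ _ := by gcongr

lemma QQi_le (h0 : 0 < s0) (hw : Integrable (fun θ => Real.exp (-(s0 ^ 2 * ‖θ‖ ^ 2 / 2))) ν)
    {s : ℝ} (hs : s0 < s) (ξ : EuclideanSpace ℝ (Fin p)) (i : Fin p) :
    QQi ν i s ξ ≤ QQ ν s ξ :=
  integral_mono (ee_coord_sq_int h0 hw hs ξ i) (ee_sq_int h0 hw hs ξ) fun θ =>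
    mul_le_mul_of_nonneg_left (coord_sq_le θ i) (ee_pos _ _ _).le

lemma QQi_nonneg (s : ℝ) (ξ : EuclideanSpace ℝ (Fin p)) (i : Fin p) : 0 ≤ QQi ν i s ξ :=
  integral_nonneg fun θ => mul_nonneg (ee_pos _ _ _).le (sq_nonneg _)

lemma TT_line (h0 : 0 < s0) (hw : Integrable (fun θ => Real.exp (-(s0 ^ 2 * ‖θ‖ ^ 2 / 2))) ν)
    {s : ℝ} (hs : s0 < s) (ξ : EuclideanSpace ℝ (Fin p)) (i : Fin p) (hM : 0 < MM ν s ξ) :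
    HasLineDerivAt ℝ (fun ξ => TT ν s ξ i) (s * (QQi ν i s ξ / MM ν s ξ - TT ν s ξ i ^ 2)) ξ
      (EuclideanSpace.single i 1) := by
  have h1 := MM_line h0 hw hs ξ i
  have h2 := NN_line h0 hw hs ξ i
  unfold HasLineDerivAt at *
  have e : ∀ z, TT ν s z i = NN ν s z i / MM ν s z := by
    intro z; unfold TT; simp [div_eq_inv_mul]
  simp_rw [e]
  have h3 := h2.div h1 (by simpa using hM.ne')
  refine h3.congr_deriv ?_
  simp only [zero_smul, add_zero]
  field_simp

variable [SFinite ν]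

lemma MM_meas (s : ℝ) : StronglyMeasurable (MM ν s) :=
  StronglyMeasurable.integral_prod_right (ee_cont2 s).stronglyMeasurable

lemma GG_meas (s : ℝ) : StronglyMeasurable (GG ν s) :=
  (Real.measurable_log.comp (MM_meas s).measurable).stronglyMeasurable

lemma NN_meas (s : ℝ) : StronglyMeasurable (NN ν s) :=
  StronglyMeasurable.integral_prod_right
    (f := fun ξ θ => ee s ξ θ • θ) (by
      have := ee_cont2 (p := p) s
      exact (this.smul continuous_snd).stronglyMeasurable)

lemma TT_meas (s : ℝ) : StronglyMeasurable (TT ν s) :=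
  ((MM_meas s).measurable.inv.stronglyMeasurable).smul (NN_meas s)

lemma QQ_meas (s : ℝ) : StronglyMeasurable (QQ ν s) :=
  StronglyMeasurable.integral_prod_right
    (f := fun ξ θ => ee s ξ θ * ‖θ‖ ^ 2) (by
      have := ee_cont2 (p := p) s
      exact (this.mul (continuous_snd.norm.pow 2)).stronglyMeasurable)

lemma QQi_meas (i : Fin p) (s : ℝ) : StronglyMeasurable (QQi ν i s) :=
  StronglyMeasurable.integral_prod_right
    (f := fun ξ θ => ee s ξ θ * θ i ^ 2) (by
      have := ee_cont2 (p := p) s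
      refine Continuous.stronglyMeasurable ?_
      unfold Function.uncurry
      fun_prop)

end PartC

section PartC

variable {p : ℕ} {ν : Measure (EuclideanSpace ℝ (Fin p))} {s0 : ℝ}
variable [SFinite ν]

/-- The quadratic bound lemmas packaged for a single `s`. -/
lemma stein_TT (h0 : 0 < s0) (hw : Integrable (fun θ => Real.exp (-(s0 ^ 2 * ‖θ‖ ^ 2 / 2))) ν)
    (hν : ν ≠ 0) {s : ℝ} (hs : s0 < s) :
    Integrable (fun ξ => ‖TT ν s ξ‖ ^ 2) (nm p 1 0) ∧
    Integrable (fun ξ => QQ ν s ξ / MM ν s ξ) (nm p 1 0) ∧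
    Integrable (fun ξ => inner ℝ ξ (TT ν s ξ)) (nm p 1 0) ∧
    ∫ ξ, inner ℝ ξ (TT ν s ξ) ∂(nm p 1 0) =
      s * (∫ ξ, QQ ν s ξ / MM ν s ξ ∂(nm p 1 0) - ∫ ξ, ‖TT ν s ξ‖ ^ 2 ∂(nm p 1 0)) := by
  obtain ⟨C, hC, hb⟩ := growth h0 hw hν (s1 := s) (s2 := s) hs
  have hM : ∀ ξ, 0 < MM ν s ξ := fun ξ => (hb s le_rfl le_rfl ξ).1
  have hQ : ∀ ξ, QQ ν s ξ / MM ν s ξ ≤ C * (1 + ‖ξ‖ ^ 2) := fun ξ => by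
    rw [div_le_iff₀ (hM ξ)]; exact (hb s le_rfl le_rfl ξ).2.2
  have hQ0 : ∀ ξ, 0 ≤ QQ ν s ξ / MM ν s ξ := fun ξ =>
    div_nonneg (integral_nonneg fun θ => mul_nonneg (ee_pos _ _ _).le (sq_nonneg _)) (hM ξ).le
  have hT : ∀ ξ, ‖TT ν s ξ‖ ^ 2 ≤ C * (1 + ‖ξ‖ ^ 2) := fun ξ => by
    refine le_trans ?_ (hQ ξ)
    rw [le_div_iff₀ (hM ξ)]; exact TT_sq_le h0 hw hs ξ (hM ξ)
  have mT := TT_meas (ν := ν) s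
  have mTi : ∀ i, Measurable (fun ξ => TT ν s ξ i) := fun i =>
    Measurable.comp (g := fun z : EuclideanSpace ℝ (Fin p) => z i) (by fun_prop) mT.measurable
  have mM := (MM_meas (ν := ν) s).measurable
  have iT : Integrable (fun ξ => ‖TT ν s ξ‖ ^ 2) (nm p 1 0) := by
    refine integrable_of_quad C (Measurable.pow_const mT.norm.measurable 2).aestronglyMeasurable fun ξ => ?_
    rw [Real.norm_of_nonneg (by positivity)]; exact hT ξ
  have iQ : Integrable (fun ξ => QQ ν s ξ / MM ν s ξ) (nm p 1 0) := by
    refine integrable_of_quad C (Measurable.div (QQ_meas (ν := ν) s).measurable mM).aestronglyMeasurable fun ξ => ?_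
    rw [Real.norm_of_nonneg (hQ0 ξ)]; exact hQ ξ
  have iTi : ∀ i, Integrable (fun ξ => TT ν s ξ i ^ 2) (nm p 1 0) := fun i => by
    refine integrable_of_quad C (Measurable.pow_const (mTi i) 2).aestronglyMeasurable fun ξ => ?_
    rw [Real.norm_of_nonneg (by positivity)]; exact (coord_sq_le _ i).trans (hT ξ)
  have iQi : ∀ i, Integrable (fun ξ => QQi ν i s ξ / MM ν s ξ) (nm p 1 0) := fun i => by
    refine integrable_of_quad C (Measurable.div (QQi_meas (ν := ν) i s).measurable mM).aestronglyMeasurable fun ξ => ?_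
    rw [Real.norm_of_nonneg (div_nonneg (QQi_nonneg s ξ i) (hM ξ).le)]
    refine le_trans ?_ (hQ ξ)
    exact div_le_div_of_nonneg_right (QQi_le h0 hw hs ξ i) (hM ξ).le
  have iX : ∀ i, Integrable (fun ξ => ξ i * TT ν s ξ i) (nm p 1 0) := fun i => by
    refine integrable_of_quad (C + 1) (Measurable.mul (by fun_prop) (mTi i)).aestronglyMeasurable fun ξ => ?_
    rw [Real.norm_eq_abs, abs_le]
    have h1 := coord_sq_le ξ i
    have h2 := (coord_sq_le _ i).trans (hT ξ)
    constructor <;> nlinarith [sq_nonneg (ξ i - TT ν s ξ i), sq_nonneg (ξ i + TT ν s ξ i)]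
  have iT1 : ∀ i, Integrable (fun ξ => TT ν s ξ i) (nm p 1 0) := fun i => by
    refine integrable_of_quad (C + 1) (mTi i).aestronglyMeasurable fun ξ => ?_
    rw [Real.norm_eq_abs, abs_le]
    have h2 := (coord_sq_le _ i).trans (hT ξ)
    constructor <;> nlinarith [sq_nonneg (TT ν s ξ i - 1), sq_nonneg (TT ν s ξ i + 1),
      sq_nonneg ‖ξ‖]
  have iS : ∀ i, Integrable (fun ξ => s * (QQi ν i s ξ / MM ν s ξ - TT ν s ξ i ^ 2)) (nm p 1 0) := fun i => by
    have h := (iQi i).sub (iTi i)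
    exact Integrable.const_mul h s
  have key : ∀ i, ∫ ξ, ξ i * TT ν s ξ i ∂(nm p 1 0) =
      s * (∫ ξ, QQi ν i s ξ / MM ν s ξ ∂(nm p 1 0) - ∫ ξ, TT ν s ξ i ^ 2 ∂(nm p 1 0)) := fun i => by
    rw [stein i (fun ξ => TT ν s ξ i) _ (fun ξ => TT_line h0 hw hs ξ i (hM ξ)) (iT1 i)
      (iS i) (iX i), integral_const_mul, integral_sub (iQi i) (iTi i)]
  have ein : ∀ ξ, inner ℝ ξ (TT ν s ξ) = ∑ i, ξ i * TT ν s ξ i := fun ξ => by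
    rw [PiLp.inner_apply]; simp [mul_comm]
  refine ⟨iT, iQ, ?_, ?_⟩
  · simp_rw [ein]
    exact integrable_finsetSum _ fun i _ => iX i
  · simp_rw [ein, QQ_sum h0 hw hs, Finset.sum_div, EuclideanSpace.real_norm_sq_eq]
    rw [integral_finsetSum _ fun i _ => iX i, integral_finsetSum _ fun i _ => iQi i,
      integral_finsetSum _ fun i _ => iTi i, ← Finset.sum_sub_distrib, Finset.mul_sum]
    exact Finset.sum_congr rfl fun i _ => key i

end PartC

section PartC

variable {p : ℕ} {ν : Measure (EuclideanSpace ℝ (Fin p))} {s0 : ℝ}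
variable [SFinite ν]

lemma GG_integrable (h0 : 0 < s0)
    (hw : Integrable (fun θ => Real.exp (-(s0 ^ 2 * ‖θ‖ ^ 2 / 2))) ν)
    (hν : ν ≠ 0) {s : ℝ} (hs : s0 < s) : Integrable (GG ν s) (nm p 1 0) := by
  obtain ⟨C, hC, hb⟩ := growth h0 hw hν (s1 := s) (s2 := s) hs
  exact integrable_of_quad C (GG_meas s).aestronglyMeasurable
    fun ξ => (hb s le_rfl le_rfl ξ).2.1

lemma HH_deriv (h0 : 0 < s0)
    (hw : Integrable (fun θ => Real.exp (-(s0 ^ 2 * ‖θ‖ ^ 2 / 2))) ν)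
    (hν : ν ≠ 0) {s : ℝ} (hs : s0 < s) :
    HasDerivAt (fun s => ∫ ξ, GG ν s ξ ∂(nm p 1 0))
      (-s * ∫ ξ, ‖TT ν s ξ‖ ^ 2 ∂(nm p 1 0)) s := by
  set s1 := (s0 + s) / 2 with hs1
  set s2 := s + 1 with hs2
  have h01 : s0 < s1 := by rw [hs1]; linarith
  obtain ⟨C, hC, hb⟩ := growth h0 hw hν (s1 := s1) (s2 := s2) h01
  obtain ⟨iT, iQ, iX, hst⟩ := stein_TT h0 hw hν hs
  have hform : ∀ t ξ, (inner ℝ ξ (NN ν t ξ) - t * QQ ν t ξ) / MM ν t ξ =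
      inner ℝ ξ (TT ν t ξ) - t * (QQ ν t ξ / MM ν t ξ) := by
    intro t ξ; unfold TT; rw [inner_smul_right]; ring
  have h := hasDerivAt_integral_of_dominated_loc_of_deriv_le (μ := nm p 1 0) (x₀ := s)
    (s := Set.Ioo s1 s2) (F := fun s ξ => GG ν s ξ)
    (F' := fun t ξ => inner ℝ ξ (TT ν t ξ) - t * (QQ ν t ξ / MM ν t ξ))
    (bound := fun ξ => (C + 1 + s2 * C) * (1 + ‖ξ‖ ^ 2))
    (Ioo_mem_nhds (by rw [hs1]; linarith) (by rw [hs2]; linarith))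
    (Eventually.of_forall fun s => (GG_meas s).aestronglyMeasurable)
    (GG_integrable h0 hw hν hs) (iX.sub (iQ.const_mul s)).aestronglyMeasurable
    (Eventually.of_forall fun ξ t ht => ?_)
    (quad_integrable _)
    (Eventually.of_forall fun ξ t ht => ?_)
  · refine h.2.congr_deriv ?_
    rw [integral_sub iX (iQ.const_mul s), integral_const_mul, hst]
    ring
  · have ht0 : s0 < t := h01.trans ht.1
    obtain ⟨hM, -, hQ⟩ := hb t ht.1.le ht.2.le ξ
    have hQ' : QQ ν t ξ / MM ν t ξ ≤ C * (1 + ‖ξ‖ ^ 2) := by rwa [div_le_iff₀ hM]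
    have hQ0 : 0 ≤ QQ ν t ξ / MM ν t ξ :=
      div_nonneg (integral_nonneg fun θ => mul_nonneg (ee_pos _ _ _).le (sq_nonneg _)) hM.le
    have hT : ‖TT ν t ξ‖ ^ 2 ≤ C * (1 + ‖ξ‖ ^ 2) := by
      refine le_trans ?_ hQ'
      rw [le_div_iff₀ hM]; exact TT_sq_le h0 hw ht0 ξ hM
    have a1 := abs_real_inner_le_norm ξ (TT ν t ξ)
    rw [Real.norm_eq_abs]
    refine (abs_sub _ _).trans ?_
    have tpos : 0 < t := h0.trans ht0
    rw [abs_of_nonneg (mul_nonneg tpos.le hQ0)]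
    have a2 : t * (QQ ν t ξ / MM ν t ξ) ≤ s2 * (C * (1 + ‖ξ‖ ^ 2)) := by
      have := ht.2.le
      have hs20 : 0 ≤ s2 := by linarith
      gcongr
    nlinarith [sq_nonneg (‖ξ‖ - ‖TT ν t ξ‖)]
  · have ht0 : s0 < t := h01.trans ht.1
    have hM := (hb t ht.1.le ht.2.le ξ).1
    unfold GG
    refine ((MM_deriv_s h0 hw ht0 ξ).log hM.ne').congr_deriv (hform t ξ)

end PartC

section PartC

variable {p : ℕ} {ν : Measure (EuclideanSpace ℝ (Fin p))} {s0 : ℝ}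
variable [SFinite ν]

/-- Continuity of the expected log-marginal at the left endpoint. -/
lemma HH_cont0 (h0 : 0 < s0) (hi : ∀ ξ, Integrable (ee s0 ξ) ν)
    (hν : ν ≠ 0) (hG : Integrable (GG ν s0) (nm p 1 0)) :
    ContinuousWithinAt (fun s => ∫ ξ, GG ν s ξ ∂(nm p 1 0)) (Set.Ici s0) s0 := by
  have hw : Integrable (fun θ => Real.exp (-(s0 ^ 2 * ‖θ‖ ^ 2 / 2))) ν := by
    refine (hi 0).congr (Eventually.of_forall fun θ => ?_)
    unfold ee; simp
  obtain ⟨c, hc, hl⟩ := lower hw hν (s0 + 1)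
  have heeI : ∀ s, s0 ≤ s → ∀ ξ, Integrable (ee s ξ) ν := fun s hs ξ => by
    refine ((hi ξ).const_mul (Real.exp (‖ξ‖ ^ 2 / 2))).mono' (ee_cont s ξ).aestronglyMeasurable
      (Eventually.of_forall fun θ => ?_)
    rw [Real.norm_of_nonneg (ee_pos _ _ _).le]
    exact K1 h0 hs ξ θ
  have hev : ∀ᶠ s in nhdsWithin s0 (Set.Ici s0), s0 ≤ s ∧ s ≤ s0 + 1 := by
    filter_upwards [self_mem_nhdsWithin,
      mem_nhdsWithin_of_mem_nhds (Iic_mem_nhds (by linarith : s0 < s0 + 1))] with s h1 h2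
    exact ⟨h1, h2⟩
  have hq : Integrable (fun ξ : EuclideanSpace ℝ (Fin p) => (c + 1) * (1 + ‖ξ‖ ^ 2)) (nm p 1 0) := quad_integrable _
  have hsum : Integrable (fun ξ => |GG ν s0 ξ| + (c + 1) * (1 + ‖ξ‖ ^ 2)) (nm p 1 0) := by
    have := hG.abs
    exact Integrable.add this hq
  refine tendsto_integral_filter_of_dominated_convergence
    (fun ξ => |GG ν s0 ξ| + (c + 1) * (1 + ‖ξ‖ ^ 2))
    (Eventually.of_forall fun s => (GG_meas s).aestronglyMeasurable) ?_
    hsum (Eventually.of_forall fun ξ => ?_)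
  · filter_upwards [hev] with s hs
    refine Eventually.of_forall fun ξ => ?_
    obtain ⟨hM, hL⟩ := hl s (h0.le.trans hs.1) hs.2 ξ (heeI s hs.1 ξ)
    obtain ⟨hM0, -⟩ := hl s0 h0.le (by linarith) ξ (hi ξ)
    have hup : MM ν s ξ ≤ Real.exp (‖ξ‖ ^ 2 / 2) * MM ν s0 ξ := by
      unfold MM; rw [← integral_const_mul]
      exact integral_mono (heeI s hs.1 ξ) ((hi ξ).const_mul _) fun θ => K1 h0 hs.1 ξ θ
    have h2 := Real.log_le_log hM hup
    rw [Real.log_mul (Real.exp_pos _).ne' hM0.ne', Real.log_exp] at h2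
    change GG ν s ξ ≤ ‖ξ‖ ^ 2 / 2 + GG ν s0 ξ at h2
    rw [Real.norm_eq_abs, abs_le]
    have h3 := le_abs_self (GG ν s0 ξ)
    have h4 := abs_nonneg (GG ν s0 ξ)
    have h5 : 0 ≤ ‖ξ‖ ^ 2 := by positivity
    constructor <;> nlinarith
  · have hM0 := (hl s0 h0.le (by linarith) ξ (hi ξ)).1
    refine Tendsto.log ?_ hM0.ne'
    refine tendsto_integral_filter_of_dominated_convergence
      (fun θ => Real.exp (‖ξ‖ ^ 2 / 2) * ee s0 ξ θ)
      (Eventually.of_forall fun s => (ee_cont s ξ).aestronglyMeasurable) ?_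
      ((hi ξ).const_mul _) (Eventually.of_forall fun θ => ?_)
    · filter_upwards [hev] with s hs
      refine Eventually.of_forall fun θ => ?_
      rw [Real.norm_of_nonneg (ee_pos _ _ _).le]
      exact K1 h0 hs.1 ξ θ
    · exact ((ee_deriv_s s0 ξ θ).continuousAt.tendsto).mono_left nhdsWithin_le_nhds

end PartC

section PartD1

variable {p : ℕ}

/-- The prior measure recentred at `μ`. -/
noncomputable def pm (π : EuclideanSpace ℝ (Fin p) → ℝ) (μ : EuclideanSpace ℝ (Fin p)) :
    Measure (EuclideanSpace ℝ (Fin p)) :=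
  (volume.withDensity (fun θ => ENNReal.ofReal (π θ))).map (fun θ => θ - μ)

instance pm_sfinite (π : EuclideanSpace ℝ (Fin p) → ℝ) (μ : EuclideanSpace ℝ (Fin p)) :
    SFinite (pm π μ) := by
  unfold pm; infer_instance

lemma prior_meas {v : ℝ} (hv : 0 < v) {π : EuclideanSpace ℝ (Fin p) → ℝ}
    (hm : ∀ z, Integrable (fun μ => gauss p v μ z * π μ)) : AEMeasurable π := by
  have h1 := (hm 0).aestronglyMeasurable.aemeasurable
  have h2 : Measurable (fun θ => (gauss p v θ 0)⁻¹) :=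
    (gauss_continuous_left v (0 : EuclideanSpace ℝ (Fin p))).measurable.inv
  refine (h2.aemeasurable.mul h1).congr (Eventually.of_forall fun θ => ?_)
  have := (gauss_pos hv θ (0 : EuclideanSpace ℝ (Fin p))).ne'
  simp only [Pi.mul_apply]
  field_simp

lemma subEmb (μ : EuclideanSpace ℝ (Fin p)) :
    MeasurableEmbedding (fun θ : EuclideanSpace ℝ (Fin p) => θ - μ) :=
  (Homeomorph.subRight μ).measurableEmbedding

lemma pm_integral {F : Type*} [NormedAddCommGroup F] [NormedSpace ℝ F]
    {π : EuclideanSpace ℝ (Fin p) → ℝ} (hπ : ∀ θ, 0 ≤ π θ) (hπm : AEMeasurable π)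
    (μ : EuclideanSpace ℝ (Fin p)) (f : EuclideanSpace ℝ (Fin p) → F) :
    ∫ z, f z ∂(pm π μ) = ∫ θ, π θ • f (θ - μ) := by
  unfold pm
  rw [(subEmb μ).integral_map,
    integral_withDensity_eq_integral_toReal_smul₀ hπm.ennreal_ofReal (by simp)]
  refine integral_congr_ae (Eventually.of_forall fun z => ?_)
  simp only
  rw [ENNReal.toReal_ofReal (hπ z)]

lemma pm_integrable {F : Type*} [NormedAddCommGroup F] [NormedSpace ℝ F]
    {π : EuclideanSpace ℝ (Fin p) → ℝ} (hπ : ∀ θ, 0 ≤ π θ) (hπm : AEMeasurable π)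
    (μ : EuclideanSpace ℝ (Fin p)) (f : EuclideanSpace ℝ (Fin p) → F) :
    Integrable f (pm π μ) ↔ Integrable (fun θ => π θ • f (θ - μ)) := by
  unfold pm
  rw [(subEmb μ).integrable_map_iff,
    integrable_withDensity_iff_integrable_smul₀' hπm.ennreal_ofReal (by simp)]
  refine integrable_congr (Eventually.of_forall fun z => ?_)
  simp only [Function.comp]
  rw [ENNReal.toReal_ofReal (hπ z)]

lemma pm_ne_zero {π : EuclideanSpace ℝ (Fin p) → ℝ} (hπ : ∀ θ, 0 ≤ π θ) (hπm : AEMeasurable π)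
    (μ : EuclideanSpace ℝ (Fin p)) (h : ¬ π =ᵐ[volume] 0) : pm π μ ≠ 0 := by
  intro h0
  unfold pm at h0
  rw [Measure.map_eq_zero_iff (subEmb μ).measurable.aemeasurable,
    withDensity_eq_zero_iff hπm.ennreal_ofReal] at h0
  apply h
  filter_upwards [h0] with θ hθ
  simp only [Pi.zero_apply, ENNReal.ofReal_eq_zero] at hθ
  exact le_antisymm hθ (hπ θ)

/-- the normalising factor -/
noncomputable def cc (v : ℝ) (ξ : EuclideanSpace ℝ (Fin p)) : ℝ :=
  (2 * Real.pi * v) ^ (-(p : ℝ) / 2) * Real.exp (-(‖ξ‖ ^ 2 / 2))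

lemma cc_pos {v : ℝ} (hv : 0 < v) (ξ : EuclideanSpace ℝ (Fin p)) : 0 < cc v ξ := by
  unfold cc; positivity

lemma gauss_ee {v : ℝ} (hv : 0 < v) (μ ξ θ : EuclideanSpace ℝ (Fin p)) :
    gauss p v θ (μ + √v • ξ) = cc v ξ * ee (√v)⁻¹ ξ (θ - μ) := by
  have hs : 0 < √v := Real.sqrt_pos.2 hv
  have hsq : √v ^ 2 = v := Real.sq_sqrt hv.le
  unfold gauss cc ee
  rw [mul_assoc (_ ^ _), ← Real.exp_add]
  congr 2
  have h1 : ‖μ + √v • ξ - θ‖ ^ 2 = √v ^ 2 * ‖ξ‖ ^ 2 - 2 * √v * inner ℝ ξ (θ - μ) + ‖θ - μ‖ ^ 2 := by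
    have : μ + √v • ξ - θ = √v • ξ - (θ - μ) := by abel
    rw [this, norm_sub_sq_real, norm_smul, mul_pow, inner_smul_left, Real.norm_of_nonneg hs.le]
    simp; ring
  rw [h1]
  have : 2 * v = 2 * √v ^ 2 := by rw [hsq]
  rw [this]
  field_simp
  ring

variable {π : EuclideanSpace ℝ (Fin p) → ℝ}

lemma ee_iff (hπ : ∀ θ, 0 ≤ π θ) (hπm : AEMeasurable π) {v : ℝ} (hv : 0 < v)
    (μ ξ : EuclideanSpace ℝ (Fin p)) :
    Integrable (fun θ => gauss p v θ (μ + √v • ξ) * π θ) ↔ Integrable (ee (√v)⁻¹ ξ) (pm π μ) := by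
  rw [pm_integrable hπ hπm]
  have h : (fun θ => gauss p v θ (μ + √v • ξ) * π θ)
      = fun θ => cc v ξ * (π θ • ee (√v)⁻¹ ξ (θ - μ)) := by
    ext θ; rw [gauss_ee hv, smul_eq_mul]; ring
  rw [h]
  exact integrable_const_mul_iff (isUnit_iff_ne_zero.2 (cc_pos hv ξ).ne') _

lemma marg_MM (hπ : ∀ θ, 0 ≤ π θ) (hπm : AEMeasurable π) {v : ℝ} (hv : 0 < v)
    (μ ξ : EuclideanSpace ℝ (Fin p)) :
    marg p v π (μ + √v • ξ) = cc v ξ * MM (pm π μ) (√v)⁻¹ ξ := by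
  unfold marg MM
  rw [pm_integral hπ hπm, ← integral_const_mul]
  refine integral_congr_ae (Eventually.of_forall fun θ => ?_)
  simp only
  rw [gauss_ee hv, smul_eq_mul]; ring

lemma log_cc {v : ℝ} (hv : 0 < v) (ξ : EuclideanSpace ℝ (Fin p)) :
    Real.log (cc v ξ) = -(p : ℝ) / 2 * Real.log (2 * Real.pi * v) - ‖ξ‖ ^ 2 / 2 := by
  unfold cc
  have := Real.pi_pos
  rw [Real.log_mul (by positivity) (by positivity), Real.log_exp, Real.log_rpow (by positivity)]
  ring

lemma postMean_TT (hπ : ∀ θ, 0 ≤ π θ) (hπm : AEMeasurable π) {v : ℝ} (hv : 0 < v)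
    (μ ξ : EuclideanSpace ℝ (Fin p)) (hM : 0 < MM (pm π μ) (√v)⁻¹ ξ)
    (hi : Integrable (ee (√v)⁻¹ ξ) (pm π μ))
    (hn : Integrable (fun θ => ee (√v)⁻¹ ξ θ • θ) (pm π μ)) :
    postMean p v π (μ + √v • ξ) - μ = TT (pm π μ) (√v)⁻¹ ξ := by
  have hc := cc_pos hv ξ
  have h : ∫ θ, (gauss p v θ (μ + √v • ξ) * π θ) • θ
      = cc v ξ • (NN (pm π μ) (√v)⁻¹ ξ + MM (pm π μ) (√v)⁻¹ ξ • μ) := by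
    have e1 : NN (pm π μ) (√v)⁻¹ ξ + MM (pm π μ) (√v)⁻¹ ξ • μ
        = ∫ θ, ee (√v)⁻¹ ξ θ • (θ + μ) ∂(pm π μ) := by
      unfold NN MM
      rw [← integral_smul_const, ← integral_add hn (hi.smul_const μ)]
      simp_rw [smul_add]
    rw [e1, pm_integral hπ hπm, ← integral_smul]
    refine integral_congr_ae (Eventually.of_forall fun θ => ?_)
    simp only
    rw [gauss_ee hv, sub_add_cancel, smul_smul, smul_smul]
    congr 1; ring
  unfold postMean TT
  rw [h, marg_MM hπ hπm hv, smul_smul, smul_add, smul_smul]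
  have e2 : (cc v ξ * MM (pm π μ) (√v)⁻¹ ξ)⁻¹ * cc v ξ = (MM (pm π μ) (√v)⁻¹ ξ)⁻¹ := by
    field_simp
  rw [e2, inv_mul_cancel₀ hM.ne', one_smul, add_sub_cancel_right]

end PartD1

section PartD2

variable {p : ℕ} {π : EuclideanSpace ℝ (Fin p) → ℝ} {vx : ℝ}

lemma pm_hi (hvx : 0 < vx) (hπ : ∀ θ, 0 ≤ π θ)
    (hm : ∀ z, Integrable (fun μ => gauss p vx μ z * π μ)) (μ ξ : EuclideanSpace ℝ (Fin p)) :
    Integrable (ee (√vx)⁻¹ ξ) (pm π μ) :=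
  (ee_iff hπ (prior_meas hvx hm) hvx μ ξ).1 (hm _)

lemma pm_hw (hvx : 0 < vx) (hπ : ∀ θ, 0 ≤ π θ)
    (hm : ∀ z, Integrable (fun μ => gauss p vx μ z * π μ)) (μ : EuclideanSpace ℝ (Fin p)) :
    Integrable (fun θ => Real.exp (-((√vx)⁻¹ ^ 2 * ‖θ‖ ^ 2 / 2))) (pm π μ) := by
  refine (pm_hi hvx hπ hm μ 0).congr (Eventually.of_forall fun θ => ?_)
  unfold ee; simp

lemma inv_sqrt_lt {v : ℝ} (hv : 0 < v) (h : v < vx) : (√vx)⁻¹ < (√v)⁻¹ :=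
  (inv_lt_inv₀ (Real.sqrt_pos.2 (hv.trans h)) (Real.sqrt_pos.2 hv)).2 (Real.sqrt_lt_sqrt hv.le h)

lemma ee_int_le (hvx : 0 < vx) (hπ : ∀ θ, 0 ≤ π θ)
    (hm : ∀ z, Integrable (fun μ => gauss p vx μ z * π μ)) (μ ξ : EuclideanSpace ℝ (Fin p))
    {v : ℝ} (hv : 0 < v) (h : v ≤ vx) : Integrable (ee (√v)⁻¹ ξ) (pm π μ) := by
  rcases h.eq_or_lt with rfl | h
  · exact pm_hi hv hπ hm μ ξ
  · exact ee_int (by positivity) (pm_hw hvx hπ hm μ) (inv_sqrt_lt hv h) ξ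

lemma MM_pos_le (hvx : 0 < vx) (hπ : ∀ θ, 0 ≤ π θ)
    (hm : ∀ z, Integrable (fun μ => gauss p vx μ z * π μ)) (hne : ¬ π =ᵐ[volume] 0)
    (μ ξ : EuclideanSpace ℝ (Fin p))
    {v : ℝ} (hv : 0 < v) (h : v ≤ vx) : 0 < MM (pm π μ) (√v)⁻¹ ξ := by
  obtain ⟨c, -, hl⟩ := lower (pm_hw hvx hπ hm μ)
    (pm_ne_zero hπ (prior_meas hvx hm) μ hne) (√v)⁻¹
  exact (hl _ (by positivity) le_rfl ξ (ee_int_le hvx hπ hm μ ξ hv h)).1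

lemma recenter {v : ℝ} (hv : 0 < v) (μ z : EuclideanSpace ℝ (Fin p)) :
    z = μ + √v • ((√v)⁻¹ • (z - μ)) := by
  have hs : 0 < √v := Real.sqrt_pos.2 hv
  rw [smul_smul, mul_inv_cancel₀ hs.ne', one_smul]; abel

lemma gauss_prior_int (hvx : 0 < vx) (hπ : ∀ θ, 0 ≤ π θ)
    (hm : ∀ z, Integrable (fun μ => gauss p vx μ z * π μ)) (z : EuclideanSpace ℝ (Fin p))
    {v : ℝ} (hv : 0 < v) (h : v ≤ vx) : Integrable (fun θ => gauss p v θ z * π θ) := by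
  rw [recenter hv 0 z]
  exact (ee_iff hπ (prior_meas hvx hm) hv 0 _).2 (ee_int_le hvx hπ hm 0 _ hv h)

lemma marg_pos (hvx : 0 < vx) (hπ : ∀ θ, 0 ≤ π θ)
    (hm : ∀ z, Integrable (fun μ => gauss p vx μ z * π μ)) (hne : ¬ π =ᵐ[volume] 0)
    (z : EuclideanSpace ℝ (Fin p))
    {v : ℝ} (hv : 0 < v) (h : v ≤ vx) : 0 < marg p v π z := by
  rw [recenter hv 0 z, marg_MM hπ (prior_meas hvx hm) hv]
  exact mul_pos (cc_pos hv _) (MM_pos_le hvx hπ hm hne _ _ hv h)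

lemma logmarg (hvx : 0 < vx) (hπ : ∀ θ, 0 ≤ π θ)
    (hm : ∀ z, Integrable (fun μ => gauss p vx μ z * π μ)) (hne : ¬ π =ᵐ[volume] 0)
    (μ ξ : EuclideanSpace ℝ (Fin p)) {v : ℝ} (hv : 0 < v) (h : v ≤ vx) :
    Real.log (marg p v π (μ + √v • ξ)) =
      (-(p : ℝ) / 2 * Real.log (2 * Real.pi * v) - ‖ξ‖ ^ 2 / 2) + GG (pm π μ) (√v)⁻¹ ξ := by
  rw [marg_MM hπ (prior_meas hvx hm) hv, Real.log_mul (cc_pos hv _).ne'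
    (MM_pos_le hvx hπ hm hne _ _ hv h).ne', log_cc hv]
  rfl

lemma const_part_int (a : ℝ) :
    Integrable (fun ξ : EuclideanSpace ℝ (Fin p) => a - ‖ξ‖ ^ 2 / 2) (nm p 1 0) := by
  have := nm_prob one_pos (0 : EuclideanSpace ℝ (Fin p))
  have h1 : Integrable (fun _ : EuclideanSpace ℝ (Fin p) => a) (nm p 1 0) := integrable_const a
  have h2 : Integrable (fun ξ : EuclideanSpace ℝ (Fin p) => ‖ξ‖ ^ 2 / 2) (nm p 1 0) :=
    sq_integrable.div_const 2
  exact Integrable.sub h1 h2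

lemma logmarg_int_iff (hvx : 0 < vx) (hπ : ∀ θ, 0 ≤ π θ)
    (hm : ∀ z, Integrable (fun μ => gauss p vx μ z * π μ)) (hne : ¬ π =ᵐ[volume] 0)
    (μ : EuclideanSpace ℝ (Fin p)) {v : ℝ} (hv : 0 < v) (h : v ≤ vx) :
    Integrable (fun z => Real.log (marg p v π z)) (nm p v μ) ↔
      Integrable (GG (pm π μ) (√v)⁻¹) (nm p 1 0) := by
  rw [nm_scale_integrable hv]
  simp_rw [fun ξ => logmarg hvx hπ hm hne μ ξ hv h]
  exact integrable_add_iff_integrable_right (const_part_int _)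

lemma logmarg_integral (hvx : 0 < vx) (hπ : ∀ θ, 0 ≤ π θ)
    (hm : ∀ z, Integrable (fun μ => gauss p vx μ z * π μ)) (hne : ¬ π =ᵐ[volume] 0)
    (μ : EuclideanSpace ℝ (Fin p)) {v : ℝ} (hv : 0 < v) (h : v ≤ vx)
    (hG : Integrable (GG (pm π μ) (√v)⁻¹) (nm p 1 0)) :
    ∫ z, Real.log (marg p v π z) ∂(nm p v μ) =
      (-(p : ℝ) / 2 * Real.log (2 * Real.pi * v) - p / 2)
        + ∫ ξ, GG (pm π μ) (√v)⁻¹ ξ ∂(nm p 1 0) := by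
  rw [nm_scale_integral hv]
  simp_rw [fun ξ => logmarg hvx hπ hm hne μ ξ hv h]
  rw [integral_add (const_part_int _) hG]
  congr 1
  have := nm_prob one_pos (0 : EuclideanSpace ℝ (Fin p))
  rw [integral_sub (integrable_const _) (sq_integrable.div_const 2), integral_div, sq_integral]
  simp

lemma qRisk_id {v : ℝ} (hv : 0 < v) (μ : EuclideanSpace ℝ (Fin p)) :
    qRisk p v μ (fun z => z) = p * v := by
  have h := nm_integral hv μ (fun z => ‖z - μ‖ ^ 2)
  unfold qRisk
  simp only [smul_eq_mul] at h
  rw [← h, nm_scale_integral hv]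
  have e : ∀ ξ : EuclideanSpace ℝ (Fin p), ‖μ + √v • ξ - μ‖ ^ 2 = v * ‖ξ‖ ^ 2 := fun ξ => by
    rw [add_sub_cancel_left, norm_smul, mul_pow, Real.norm_eq_abs, sq_abs, Real.sq_sqrt hv.le]
  simp_rw [e]
  rw [integral_const_mul, sq_integral]; ring

lemma qRisk_post (hvx : 0 < vx) (hπ : ∀ θ, 0 ≤ π θ)
    (hm : ∀ z, Integrable (fun μ => gauss p vx μ z * π μ)) (hne : ¬ π =ᵐ[volume] 0)
    (μ : EuclideanSpace ℝ (Fin p)) {v : ℝ} (hv : 0 < v) (h : v < vx) :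
    qRisk p v μ (postMean p v π) = ∫ ξ, ‖TT (pm π μ) (√v)⁻¹ ξ‖ ^ 2 ∂(nm p 1 0) := by
  have h1 := nm_integral hv μ (fun z => ‖postMean p v π z - μ‖ ^ 2)
  unfold qRisk
  simp only [smul_eq_mul] at h1
  rw [← h1, nm_scale_integral hv]
  refine integral_congr_ae (Eventually.of_forall fun ξ => ?_)
  simp only
  rw [postMean_TT hπ (prior_meas hvx hm) hv μ ξ (MM_pos_le hvx hπ hm hne μ ξ hv h.le)
    (ee_int_le hvx hπ hm μ ξ hv h.le)
    (ee_vec_int (by positivity) (pm_hw hvx hπ hm μ) (inv_sqrt_lt hv h) ξ)]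

lemma analytic (hvx : 0 < vx) (hπ : ∀ θ, 0 ≤ π θ)
    (hm : ∀ z, Integrable (fun μ => gauss p vx μ z * π μ)) (hne : ¬ π =ᵐ[volume] 0)
    (μ : EuclideanSpace ℝ (Fin p)) {vw : ℝ} (hvw : 0 < vw) (hlt : vw < vx)
    (hG : Integrable (fun z => Real.log (marg p vx π z)) (nm p vx μ)) :
    ∫ z, Real.log (marg p vw π z) ∂(nm p vw μ) - ∫ z, Real.log (marg p vx π z) ∂(nm p vx μ)
      = (1 / 2) * ∫ v in vw..vx,
          (1 / v ^ 2) * (qRisk p v μ (fun z => z) - qRisk p v μ (postMean p v π)) := by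
  have hπm := prior_meas hvx hm
  have hν := pm_ne_zero hπ hπm μ hne
  have hw := pm_hw hvx hπ hm μ
  have hi := pm_hi hvx hπ hm μ
  set ν := pm π μ with hνdef
  have hs0 : 0 < (√vx)⁻¹ := by positivity
  have hG0 : Integrable (GG ν (√vx)⁻¹) (nm p 1 0) :=
    (logmarg_int_iff hvx hπ hm hne μ hvx le_rfl).1 hG
  have hGw : Integrable (GG ν (√vw)⁻¹) (nm p 1 0) :=
    GG_integrable hs0 hw hν (inv_sqrt_lt hvw hlt)
  rw [logmarg_integral hvx hπ hm hne μ hvw hlt.le hGw,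
    logmarg_integral hvx hπ hm hne μ hvx le_rfl hG0]
  set H : ℝ → ℝ := fun s => ∫ ξ, GG ν s ξ ∂(nm p 1 0) with hH
  set E : ℝ → ℝ := fun v => ∫ ξ, ‖TT ν (√v)⁻¹ ξ‖ ^ 2 ∂(nm p 1 0) with hE
  set K : ℝ → ℝ := fun v => H (√v)⁻¹ with hK
  have hder : ∀ v, 0 < v → v < vx → HasDerivAt K (1 / 2 * (1 / v ^ 2 * E v)) v := by
    intro v hv h
    have h1 : HasDerivAt H _ (√v)⁻¹ := HH_deriv hs0 hw hν (inv_sqrt_lt hv h)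
    have hsv : 0 < √v := Real.sqrt_pos.2 hv
    have h2 := (Real.hasDerivAt_sqrt hv.ne').inv hsv.ne'
    have h3 := HasDerivAt.comp v h1 h2
    refine h3.congr_deriv ?_
    have hvv : v = √v ^ 2 := (Real.sq_sqrt hv.le).symm
    simp only [hE]
    generalize (∫ ξ, ‖TT ν (√v)⁻¹ ξ‖ ^ 2 ∂(nm p 1 0)) = e
    have : v ^ 2 = √v ^ 4 := by rw [show √v ^ 4 = (√v ^ 2) ^ 2 by ring, ← hvv]
    rw [this]
    field_simp
  have hcont : ContinuousOn K (Set.Icc vw vx) := by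
    intro v hv
    have hv0 : 0 < v := hvw.trans_le hv.1
    rcases hv.2.eq_or_lt with rfl | h
    · have h1 := HH_cont0 hs0 hi hν hG0
      have h2 : ContinuousWithinAt (fun v : ℝ => (√v)⁻¹) (Set.Icc vw v) v :=
        (Real.continuous_sqrt.continuousAt.inv₀ (Real.sqrt_pos.2 hv0).ne').continuousWithinAt
      refine ContinuousWithinAt.comp (g := H) (t := Set.Ici (√v)⁻¹) h1 h2 ?_
      intro u hu
      exact (inv_le_inv₀ (Real.sqrt_pos.2 hv0) (Real.sqrt_pos.2 (hvw.trans_le hu.1))).2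
        (Real.sqrt_le_sqrt hu.2)
    · exact (hder v hv0 h).continuousAt.continuousWithinAt
  have hE0 : ∀ v, 0 ≤ E v := fun v => integral_nonneg fun ξ => by positivity
  have hii : IntervalIntegrable (fun v => 1 / 2 * (1 / v ^ 2 * E v)) volume vw vx := by
    refine intervalIntegral.intervalIntegrable_deriv_of_nonneg (g := K) ?_ ?_ ?_
    · rwa [Set.uIcc_of_le hlt.le]
    · intro v hv
      rw [min_eq_left hlt.le, max_eq_right hlt.le] at hv
      exact hder v (hvw.trans hv.1) hv.2
    · intro v hv
      have := hE0 v
      positivity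
  have hFTC := intervalIntegral.integral_eq_sub_of_hasDerivAt_of_le hlt.le hcont
    (fun v hv => hder v (hvw.trans hv.1) hv.2) hii
  have h1v : IntervalIntegrable (fun v : ℝ => v⁻¹) volume vw vx := by
    refine intervalIntegral.intervalIntegrable_inv (fun v hv => ?_) continuousOn_id
    rw [Set.uIcc_of_le hlt.le] at hv
    exact (hvw.trans_le hv.1).ne'
  have hEq : ∫ v in vw..vx,
        (1 / v ^ 2) * (qRisk p v μ (fun z => z) - qRisk p v μ (postMean p v π))
      = ∫ v in vw..vx, ((p : ℝ) * v⁻¹ - 2 * (1 / 2 * (1 / v ^ 2 * E v))) := by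
    rw [intervalIntegral.integral_of_le hlt.le, intervalIntegral.integral_of_le hlt.le,
      integral_Ioc_eq_integral_Ioo, integral_Ioc_eq_integral_Ioo]
    refine setIntegral_congr_fun measurableSet_Ioo fun v hv => ?_
    have hv0 : 0 < v := hvw.trans hv.1
    rw [qRisk_id hv0, qRisk_post hvx hπ hm hne μ hv0 hv.2]
    simp only [hE, ← hνdef]
    field_simp
  rw [hEq, intervalIntegral.integral_sub (h1v.const_mul _) (hii.const_mul 2),
    intervalIntegral.integral_const_mul, intervalIntegral.integral_const_mul, hFTC,
    integral_inv_of_pos hvw hvx]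
  have hpi := Real.pi_pos
  rw [Real.log_mul (by positivity) hvw.ne', Real.log_mul (by positivity) hvx.ne',
    Real.log_div hvx.ne' hvw.ne']
  simp only [hK]
  ring

end PartD2

section PartD3

variable {p : ℕ} {vx vy : ℝ}

/-- the sufficient statistic -/
noncomputable def WW (vx vy : ℝ) (x y : EuclideanSpace ℝ (Fin p)) : EuclideanSpace ℝ (Fin p) :=
  (vx + vy)⁻¹ • (vy • x + vx • y)

lemma WW_cont (vx vy : ℝ) : Continuous (fun q : EuclideanSpace ℝ (Fin p) × EuclideanSpace ℝ (Fin p) =>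
    WW vx vy q.1 q.2) := by
  unfold WW; fun_prop

lemma WW_norm (hvx : 0 < vx) (hvy : 0 < vy) (θ x y : EuclideanSpace ℝ (Fin p)) :
    ‖x - θ‖ ^ 2 / (2 * vx) + ‖y - θ‖ ^ 2 / (2 * vy) =
      ‖WW vx vy x y - θ‖ ^ 2 / (2 * (vx * vy / (vx + vy))) + ‖y - x‖ ^ 2 / (2 * (vx + vy)) := by
  have hs : 0 < vx + vy := by linarith
  have h1 : WW vx vy x y - θ = (vx + vy)⁻¹ • (vy • (x - θ) + vx • (y - θ)) := by
    have : θ = (vx + vy)⁻¹ • ((vx + vy) • θ) := by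
      rw [smul_smul, inv_mul_cancel₀ hs.ne', one_smul]
    unfold WW
    conv_lhs => rw [this]
    rw [← smul_sub]
    congr 1
    simp only [smul_sub, add_smul]
    abel
  have h2 : y - x = (y - θ) - (x - θ) := by abel
  rw [h1, h2, norm_smul, mul_pow, norm_add_sq_real, norm_sub_sq_real (y - θ), norm_smul, norm_smul,
    inner_smul_left, inner_smul_right, real_inner_comm (x - θ) (y - θ)]
  simp only [Real.norm_eq_abs, mul_pow, sq_abs, conj_trivial, norm_inv, inv_pow]
  field_simp
  ring

lemma gauss_factor (hvx : 0 < vx) (hvy : 0 < vy) (θ x y : EuclideanSpace ℝ (Fin p)) :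
    gauss p vx θ x * gauss p vy θ y =
      gauss p (vx * vy / (vx + vy)) θ (WW vx vy x y) * gauss p (vx + vy) x y := by
  have hs : 0 < vx + vy := by linarith
  have hpi := Real.pi_pos
  unfold gauss
  have hmm : ∀ a b c d : ℝ, a * Real.exp b * (c * Real.exp d) = (a * c) * Real.exp (b + d) := by
    intro a b c d; rw [Real.exp_add]; ring
  rw [hmm, hmm,
    ← Real.mul_rpow (by positivity) (by positivity), ← Real.mul_rpow (by positivity) (by positivity)]
  congr 2
  · field_simp
  · have := WW_norm hvx hvy θ x y
    simp only [neg_div]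
    linarith

lemma bayesRule_eq (hvx : 0 < vx) (hvy : 0 < vy) (π : EuclideanSpace ℝ (Fin p) → ℝ)
    (x y : EuclideanSpace ℝ (Fin p)) :
    bayesRule p vx vy π x y = gauss p (vx + vy) x y *
      marg p (vx * vy / (vx + vy)) π (WW vx vy x y) / marg p vx π x := by
  unfold bayesRule
  congr 1
  unfold marg
  rw [← integral_const_mul]
  refine integral_congr_ae (Eventually.of_forall fun θ => ?_)
  simp only
  rw [gauss_factor hvx hvy]; ring

lemma nm_lintegral {v : ℝ} (μ : EuclideanSpace ℝ (Fin p)) (g : EuclideanSpace ℝ (Fin p) → ℝ≥0∞) :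
    ∫⁻ z, g z ∂(nm p v μ) = ∫⁻ z, ENNReal.ofReal (gauss p v μ z) * g z := by
  unfold nm
  rw [lintegral_withDensity_eq_lintegral_mul_non_measurable _ (nm_meas v μ)
    (Eventually.of_forall fun z => ENNReal.ofReal_lt_top)]
  rfl

lemma WW_shift (hvx : 0 < vx) (hvy : 0 < vy) (x d : EuclideanSpace ℝ (Fin p)) :
    WW vx vy x (x + d) = x + ((vx + vy)⁻¹ * vx) • d := by
  have hs : 0 < vx + vy := by linarith
  unfold WW
  rw [smul_add vx, ← add_assoc, ← add_smul, smul_add, smul_smul, smul_smul, add_comm vy vx,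
    inv_mul_cancel₀ hs.ne', one_smul]

lemma WW_lintegral (hvx : 0 < vx) (hvy : 0 < vy) (μ : EuclideanSpace ℝ (Fin p))
    (g : EuclideanSpace ℝ (Fin p) → ℝ≥0∞) (hg : Measurable g) :
    ∫⁻ q, g (WW vx vy q.1 q.2) ∂((nm p vx μ).prod (nm p vy μ)) =
      ∫⁻ z, g z ∂(nm p (vx * vy / (vx + vy)) μ) := by
  have hs : 0 < vx + vy := by linarith
  set vw := vx * vy / (vx + vy) with hvw
  have mW : Measurable (fun q : EuclideanSpace ℝ (Fin p) × EuclideanSpace ℝ (Fin p) =>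
    g (WW vx vy q.1 q.2)) := hg.comp (WW_cont vx vy).measurable
  rw [lintegral_prod _ mW.aemeasurable]
  have h1 : ∀ x, ∫⁻ y, g (WW vx vy x y) ∂(nm p vy μ)
      = ∫⁻ y, ENNReal.ofReal (gauss p vy μ y) * g (WW vx vy x y) := fun x => nm_lintegral μ _
  simp only [h1]
  rw [nm_lintegral]
  set c := (vx + vy)⁻¹ * vx with hc
  set k : EuclideanSpace ℝ (Fin p) → ℝ≥0∞ := fun z => ENNReal.ofReal (gauss p vw μ z) * g z with hk
  have mk : Measurable k := (nm_meas vw μ).mul hg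
  have h2 : ∀ x, ENNReal.ofReal (gauss p vx μ x) *
      ∫⁻ y, ENNReal.ofReal (gauss p vy μ y) * g (WW vx vy x y)
      = ∫⁻ d, ENNReal.ofReal (gauss p (vx + vy) 0 d) * k (x + c • d) := by
    intro x
    rw [← lintegral_const_mul' _ _ ENNReal.ofReal_ne_top,
      ← lintegral_add_left_eq_self _ x]
    refine lintegral_congr fun d => ?_
    rw [← mul_assoc, ← ENNReal.ofReal_mul (gauss_pos hvx μ x).le, gauss_factor hvx hvy,
      WW_shift hvx hvy, ENNReal.ofReal_mul (gauss_pos (by positivity) _ _).le,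
      gauss_zero (vx + vy) x, add_sub_cancel_left]
    simp only [hk]
    ring
  simp only [h2]
  have mg := (gauss_continuous_right (vx + vy) (0 : EuclideanSpace ℝ (Fin p))).measurable.ennreal_ofReal
  rw [lintegral_lintegral_swap]
  · have h3 : ∀ d, ∫⁻ x, ENNReal.ofReal (gauss p (vx + vy) 0 d) * k (x + c • d)
        = ENNReal.ofReal (gauss p (vx + vy) 0 d) * ∫⁻ x, k x := by
      intro d
      rw [lintegral_const_mul' _ _ ENNReal.ofReal_ne_top, lintegral_add_right_eq_self k]
    simp only [h3]
    rw [lintegral_mul_const _ mg, ← ofReal_integral_eq_lintegral_ofReal (gauss_integrable hs 0)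
      (Eventually.of_forall fun z => (gauss_pos hs 0 z).le), gauss_integral hs, ENNReal.ofReal_one,
      one_mul, nm_lintegral]
  · refine Measurable.aemeasurable ?_
    exact (mg.comp measurable_snd).mul (mk.comp (by fun_prop))

lemma WW_mp (hvx : 0 < vx) (hvy : 0 < vy) (μ : EuclideanSpace ℝ (Fin p)) :
    MeasurePreserving (fun q : EuclideanSpace ℝ (Fin p) × EuclideanSpace ℝ (Fin p) =>
      WW vx vy q.1 q.2) ((nm p vx μ).prod (nm p vy μ)) (nm p (vx * vy / (vx + vy)) μ) := by
  refine ⟨(WW_cont vx vy).measurable, ?_⟩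
  refine Measure.ext_of_lintegral _ fun g hg => ?_
  rw [lintegral_map hg (WW_cont vx vy).measurable, WW_lintegral hvx hvy μ g hg]

end PartD3

section PartD4

variable {p : ℕ} {vx vy : ℝ} {π : EuclideanSpace ℝ (Fin p) → ℝ}

lemma norm_sub_sq_int {v : ℝ} (hv : 0 < v) (μ : EuclideanSpace ℝ (Fin p)) :
    Integrable (fun z => ‖z - μ‖ ^ 2) (nm p v μ) := by
  rw [nm_scale_integrable hv]
  have e : ∀ ξ : EuclideanSpace ℝ (Fin p), ‖μ + √v • ξ - μ‖ ^ 2 = v * ‖ξ‖ ^ 2 := fun ξ => by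
    rw [add_sub_cancel_left, norm_smul, mul_pow, Real.norm_eq_abs, sq_abs, Real.sq_sqrt hv.le]
  simp_rw [e]
  exact sq_integrable.const_mul v

lemma log_gauss {v : ℝ} (hv : 0 < v) (μ z : EuclideanSpace ℝ (Fin p)) :
    Real.log (gauss p v μ z) = -(p : ℝ) / 2 * Real.log (2 * Real.pi * v) - ‖z - μ‖ ^ 2 / (2 * v) := by
  unfold gauss
  have := Real.pi_pos
  rw [Real.log_mul (by positivity) (by positivity), Real.log_exp, Real.log_rpow (by positivity)]
  ring

/-- log-likelihood ratio for the uniform prior -/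
noncomputable def lU (vx vy : ℝ) (μ x y : EuclideanSpace ℝ (Fin p)) : ℝ :=
  Real.log (gauss p vy μ y) - Real.log (gauss p (vx + vy) x y)

lemma lU_int (hvx : 0 < vx) (hvy : 0 < vy) (μ : EuclideanSpace ℝ (Fin p)) :
    Integrable (fun q : EuclideanSpace ℝ (Fin p) × EuclideanSpace ℝ (Fin p) =>
      lU vx vy μ q.1 q.2) ((nm p vx μ).prod (nm p vy μ)) := by
  have hs : 0 < vx + vy := by linarith
  have i1 := nm_prob hvx μ
  have i2 := nm_prob hvy μ
  have h1 : Integrable (fun q : EuclideanSpace ℝ (Fin p) × EuclideanSpace ℝ (Fin p) =>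
      ‖q.1 - μ‖ ^ 2) ((nm p vx μ).prod (nm p vy μ)) := (norm_sub_sq_int hvx μ).comp_fst _
  have h2 : Integrable (fun q : EuclideanSpace ℝ (Fin p) × EuclideanSpace ℝ (Fin p) =>
      ‖q.2 - μ‖ ^ 2) ((nm p vx μ).prod (nm p vy μ)) := (norm_sub_sq_int hvy μ).comp_snd _
  have h3 : Integrable (fun q : EuclideanSpace ℝ (Fin p) × EuclideanSpace ℝ (Fin p) =>
      ‖q.2 - q.1‖ ^ 2) ((nm p vx μ).prod (nm p vy μ)) := by
    refine Integrable.mono' ((h1.const_mul 2).add (h2.const_mul 2))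
      (Continuous.aestronglyMeasurable (by fun_prop)) (Eventually.of_forall fun q => ?_)
    rw [Real.norm_of_nonneg (by positivity)]
    simp only [Pi.add_apply]
    have : q.2 - q.1 = (q.2 - μ) - (q.1 - μ) := by abel
    have h := norm_sub_le (q.2 - μ) (q.1 - μ)
    rw [← this] at h
    have h0 := norm_nonneg (q.2 - q.1)
    nlinarith [sq_nonneg (‖q.2 - μ‖ - ‖q.1 - μ‖), norm_nonneg (q.2 - μ), norm_nonneg (q.1 - μ)]
  unfold lU
  simp_rw [log_gauss hvy, log_gauss hs]
  refine Integrable.sub (Integrable.sub (integrable_const _) ?_)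
    (Integrable.sub (integrable_const _) ?_)
  · exact h2.div_const _
  · exact h3.div_const _

lemma logmarg_meas (hvx : 0 < vx) (hπ : ∀ θ, 0 ≤ π θ)
    (hm : ∀ z, Integrable (fun μ => gauss p vx μ z * π μ)) (hne : ¬ π =ᵐ[volume] 0)
    {v : ℝ} (hv : 0 < v) (h : v ≤ vx) :
    Measurable (fun z => Real.log (marg p v π z)) := by
  have e : (fun z => Real.log (marg p v π z)) = fun z =>
      (-(p : ℝ) / 2 * Real.log (2 * Real.pi * v) - ‖(√v)⁻¹ • (z - 0)‖ ^ 2 / 2)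
        + GG (pm π 0) (√v)⁻¹ ((√v)⁻¹ • (z - 0)) := by
    ext z
    rw [← logmarg hvx hπ hm hne 0 _ hv h, ← recenter hv]
  rw [e]
  have hg := (GG_meas (ν := pm π 0) (√v)⁻¹).measurable
  have hz : Measurable (fun z : EuclideanSpace ℝ (Fin p) => (√v)⁻¹ • (z - 0)) := by fun_prop
  exact Measurable.add (by fun_prop) (hg.comp hz)

lemma bayes_prod_int (hvx : 0 < vx) (hvy : 0 < vy)
    (hm : ∀ z, Integrable (fun μ => gauss p vx μ z * π μ)) (x : EuclideanSpace ℝ (Fin p)) :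
    Integrable (fun q : EuclideanSpace ℝ (Fin p) × EuclideanSpace ℝ (Fin p) =>
      gauss p vx q.2 x * gauss p vy q.2 q.1 * π q.2) (volume.prod volume) := by
  have hπm := prior_meas hvx hm
  have hmeas : AEStronglyMeasurable (fun q : EuclideanSpace ℝ (Fin p) × EuclideanSpace ℝ (Fin p) =>
      gauss p vx q.2 x * gauss p vy q.2 q.1 * π q.2) (volume.prod volume) := by
    have h1 : AEStronglyMeasurable (fun q : EuclideanSpace ℝ (Fin p) × EuclideanSpace ℝ (Fin p) =>
      π q.2) (volume.prod volume) := hπm.aestronglyMeasurable.comp_snd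
    have c1 : Continuous (fun q : EuclideanSpace ℝ (Fin p) × EuclideanSpace ℝ (Fin p) =>
        gauss p vx q.2 x) := by unfold gauss; fun_prop
    have c2 : Continuous (fun q : EuclideanSpace ℝ (Fin p) × EuclideanSpace ℝ (Fin p) =>
        gauss p vy q.2 q.1) := by unfold gauss; fun_prop
    exact AEStronglyMeasurable.mul (c1.mul c2).aestronglyMeasurable h1
  refine (integrable_prod_iff' hmeas).2 ⟨Eventually.of_forall fun θ => ?_, ?_⟩
  · exact ((gauss_integrable hvy θ).const_mul (gauss p vx θ x)).mul_const (π θ)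
  · have e : ∀ θ, ∫ y, ‖gauss p vx θ x * gauss p vy θ y * π θ‖ = ‖gauss p vx θ x * π θ‖ := by
      intro θ
      have : ∀ y, ‖gauss p vx θ x * gauss p vy θ y * π θ‖ = ‖gauss p vx θ x * π θ‖ * gauss p vy θ y := by
        intro y
        rw [norm_mul, norm_mul, norm_mul, Real.norm_of_nonneg (gauss_pos hvy θ y).le]; ring
      simp_rw [this]
      rw [integral_const_mul, gauss_integral hvy, mul_one]
    simp only [e]
    exact (hm x).norm

lemma bayes_int (hvx : 0 < vx) (hvy : 0 < vy)
    (hm : ∀ z, Integrable (fun μ => gauss p vx μ z * π μ)) (x : EuclideanSpace ℝ (Fin p))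
    (hpos : 0 < marg p vx π x) :
    Integrable (fun y => bayesRule p vx vy π x y) ∧ ∫ y, bayesRule p vx vy π x y = 1 := by
  have h := bayes_prod_int hvx hvy hm x
  unfold bayesRule
  refine ⟨h.integral_prod_left.div_const _, ?_⟩
  rw [integral_div, integral_integral_swap h]
  have e : ∀ θ, ∫ y, gauss p vx θ x * gauss p vy θ y * π θ = gauss p vx θ x * π θ := by
    intro θ
    rw [integral_mul_const, integral_const_mul, gauss_integral hvy, mul_one]
  simp only [e]
  exact div_self hpos.ne'

lemma vol_ac_nm {v : ℝ} (hv : 0 < v) (μ : EuclideanSpace ℝ (Fin p)) :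
    (volume : Measure (EuclideanSpace ℝ (Fin p))) ≪ nm p v μ := by
  unfold nm
  refine withDensity_absolutelyContinuous' (nm_meas v μ).aemeasurable
    (Eventually.of_forall fun z => ?_)
  simpa using gauss_pos hv μ z

/-- The key representation of the KL risk of a formal Bayes rule. -/
lemma klRisk_rep (hvx : 0 < vx) (hvy : 0 < vy) (hπ : ∀ θ, 0 ≤ π θ)
    (hm : ∀ z, Integrable (fun μ => gauss p vx μ z * π μ)) (hne : ¬ π =ᵐ[volume] 0)
    (μ : EuclideanSpace ℝ (Fin p))
    (hor : klRisk p vx vy μ (bayesRule p vx vy π) < ⊤ ∨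
      Integrable (fun z => Real.log (marg p vx π z)) (nm p vx μ)) :
    Integrable (fun z => Real.log (marg p vx π z)) (nm p vx μ) ∧
    (klRisk p vx vy μ (bayesRule p vx vy π)).toReal =
      ∫ q, lU vx vy μ q.1 q.2 ∂((nm p vx μ).prod (nm p vy μ))
      - ∫ z, Real.log (marg p (vx * vy / (vx + vy)) π z) ∂(nm p (vx * vy / (vx + vy)) μ)
      + ∫ z, Real.log (marg p vx π z) ∂(nm p vx μ) := by
  have hs : 0 < vx + vy := by linarith
  have hvw : 0 < vx * vy / (vx + vy) := by positivity
  have hlt : vx * vy / (vx + vy) < vx := by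
    rw [div_lt_iff₀ hs]; nlinarith
  set vw := vx * vy / (vx + vy) with hvwdef
  have hπm := prior_meas hvx hm
  have i1 := nm_prob hvx μ
  have i2 := nm_prob hvy μ
  have hLw : Integrable (fun z => Real.log (marg p vw π z)) (nm p vw μ) :=
    (logmarg_int_iff hvx hπ hm hne μ hvw hlt.le).2 (GG_integrable (by positivity)
      (pm_hw hvx hπ hm μ) (pm_ne_zero hπ hπm μ hne) (inv_sqrt_lt hvw hlt))
  have mp := WW_mp hvx hvy μ
  rw [← hvwdef] at mp
  have hLW : Integrable (fun q : EuclideanSpace ℝ (Fin p) × EuclideanSpace ℝ (Fin p) =>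
      Real.log (marg p vw π (WW vx vy q.1 q.2))) ((nm p vx μ).prod (nm p vy μ)) :=
    mp.integrable_comp_of_integrable hLw
  have hLWi : ∫ q : EuclideanSpace ℝ (Fin p) × EuclideanSpace ℝ (Fin p),
      Real.log (marg p vw π (WW vx vy q.1 q.2)) ∂((nm p vx μ).prod (nm p vy μ))
      = ∫ z, Real.log (marg p vw π z) ∂(nm p vw μ) := by
    have h := integral_map (μ := (nm p vx μ).prod (nm p vy μ)) mp.measurable.aemeasurable
      (f := fun z => Real.log (marg p vw π z)) (by rw [mp.map_eq]; exact hLw.aestronglyMeasurable)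
    rw [mp.map_eq] at h
    exact h.symm
  have hU := lU_int hvx hvy μ
  set F : EuclideanSpace ℝ (Fin p) × EuclideanSpace ℝ (Fin p) → ℝ := fun q =>
    lU vx vy μ q.1 q.2 - Real.log (marg p vw π (WW vx vy q.1 q.2)) with hF
  have hFi : Integrable F ((nm p vx μ).prod (nm p vy μ)) := hU.sub hLW
  set C : EuclideanSpace ℝ (Fin p) → ℝ := fun x => ∫ y, F (x, y) ∂(nm p vy μ) with hC
  have hCi : Integrable C (nm p vx μ) := hFi.integral_prod_left
  have hCint : ∫ x, C x ∂(nm p vx μ) =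
      ∫ q, lU vx vy μ q.1 q.2 ∂((nm p vx μ).prod (nm p vy μ))
      - ∫ z, Real.log (marg p vw π z) ∂(nm p vw μ) := by
    rw [← hLWi, ← integral_sub hU hLW]
    exact (integral_prod F hFi).symm
  set l : EuclideanSpace ℝ (Fin p) → ℝ := fun z => Real.log (marg p vx π z) with hl
  have hlm : Measurable l := logmarg_meas hvx hπ hm hne hvx le_rfl
  have hbpos : ∀ x y, 0 < bayesRule p vx vy π x y := fun x y => by
    rw [bayesRule_eq hvx hvy]
    exact div_pos (mul_pos (gauss_pos hs x y) (marg_pos hvx hπ hm hne _ hvw hlt.le))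
      (marg_pos hvx hπ hm hne _ hvx le_rfl)
  have hlog : ∀ x y, Real.log (gauss p vy μ y / bayesRule p vx vy π x y) = F (x, y) + l x := by
    intro x y
    rw [Real.log_div (gauss_pos hvy μ y).ne' (hbpos x y).ne', bayesRule_eq hvx hvy,
      Real.log_div (mul_pos (gauss_pos hs x y) (marg_pos hvx hπ hm hne _ hvw hlt.le)).ne'
        (marg_pos hvx hπ hm hne _ hvx le_rfl).ne',
      Real.log_mul (gauss_pos hs x y).ne' (marg_pos hvx hπ hm hne _ hvw hlt.le).ne']
    simp only [hF, hl, lU]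
    ring
  have hae : ∀ᵐ x ∂(nm p vx μ), Integrable (fun y => F (x, y)) (nm p vy μ) := hFi.prod_right_ae
  have hloss : ∀ᵐ x ∂(nm p vx μ), klLoss p vy μ (bayesRule p vx vy π x) = ENNReal.ofReal (C x + l x)
      ∧ 0 ≤ C x + l x := by
    filter_upwards [hae] with x hx
    have hx' : Integrable (fun y => F (x, y) + l x) (nm p vy μ) := hx.add (integrable_const _)
    have hval : ∫ y, (F (x, y) + l x) ∂(nm p vy μ) = C x + l x := by
      rw [integral_add hx (integrable_const _)]
      simp [hC]
    have e1 : (fun y => gauss p vy μ y * Real.log (gauss p vy μ y / bayesRule p vx vy π x y))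
        = fun y => gauss p vy μ y • (F (x, y) + l x) := by
      ext y; rw [hlog, smul_eq_mul]
    constructor
    · unfold klLoss
      have hI : Integrable (fun y => gauss p vy μ y *
          Real.log (gauss p vy μ y / bayesRule p vx vy π x y)) := by
        rw [e1, ← nm_integrable hvy]; exact hx'
      rw [if_pos ⟨Eventually.of_forall (hbpos x), hI⟩, e1, ← nm_integral hvy, hval]
    · rw [← hval]
      obtain ⟨b1, b2⟩ := bayes_int hvx hvy hm x (marg_pos hvx hπ hm hne x hvx le_rfl)
      have e2 : (fun y => gauss p vy μ y • (bayesRule p vx vy π x y / gauss p vy μ y))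
          = fun y => bayesRule p vx vy π x y := by
        ext y
        have := (gauss_pos hvy μ y).ne'
        rw [smul_eq_mul]; field_simp
      have b3 : Integrable (fun y => bayesRule p vx vy π x y / gauss p vy μ y) (nm p vy μ) := by
        rw [nm_integrable hvy, e2]; exact b1
      have b4 : ∫ y, (1 - bayesRule p vx vy π x y / gauss p vy μ y) ∂(nm p vy μ) = 0 := by
        rw [integral_sub (integrable_const _) b3, nm_integral hvy μ
          (fun y => bayesRule p vx vy π x y / gauss p vy μ y), e2, b2]
        simp
      rw [← b4]
      refine integral_mono (Integrable.sub (integrable_const _) b3) hx' fun y => ?_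
      simp only
      rw [← hlog]
      have := Real.one_sub_inv_le_log_of_pos (div_pos (gauss_pos hvy μ y) (hbpos x y))
      rwa [inv_div] at this
  have hrisk : klRisk p vx vy μ (bayesRule p vx vy π)
      = ∫⁻ x, ENNReal.ofReal (C x + l x) ∂(nm p vx μ) := by
    have e : klRisk p vx vy μ (bayesRule p vx vy π)
        = ∫⁻ x, klLoss p vy μ (bayesRule p vx vy π x) ∂(nm p vx μ) := by
      rw [nm_lintegral]; unfold klRisk; simp_rw [mul_comm]
    rw [e]
    exact lintegral_congr_ae (hloss.mono fun x hx => hx.1)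
  have hnn : 0 ≤ᵐ[nm p vx μ] fun x => C x + l x := hloss.mono fun x hx => hx.2
  have hAm : AEStronglyMeasurable (fun x => C x + l x) (nm p vx μ) :=
    hCi.aestronglyMeasurable.add hlm.aestronglyMeasurable
  have hli : Integrable l (nm p vx μ) := by
    rcases hor with h | h
    · rw [hrisk] at h
      have hA := (lintegral_ofReal_ne_top_iff_integrable hAm hnn).1 h.ne
      have : l = fun x => (C x + l x) - C x := by ext x; ring
      rw [this]
      exact Integrable.sub hA hCi
    · exact h
  refine ⟨hli, ?_⟩
  rw [hrisk, ← integral_eq_lintegral_of_nonneg_ae hnn hAm, integral_add hCi hli, hCint]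

end PartD4

section PartD5

variable {p : ℕ} {vx vy : ℝ} {π : EuclideanSpace ℝ (Fin p) → ℝ}

lemma prior_ne_zero (hvx : 0 < vx) (μ : EuclideanSpace ℝ (Fin p))
    (hR : klRisk p vx vy μ (bayesRule p vx vy π) < ⊤) : ¬ π =ᵐ[volume] 0 := by
  intro h
  have hb : ∀ x y, bayesRule p vx vy π x y = 0 := by
    intro x y
    unfold bayesRule
    rw [integral_eq_zero_of_ae, zero_div]
    filter_upwards [h] with θ hθ
    simp [hθ]
  have hl : ∀ x, klLoss p vy μ (bayesRule p vx vy π x) = ⊤ := by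
    intro x
    unfold klLoss
    rw [if_neg]
    rintro ⟨h1, -⟩
    obtain ⟨y, hy⟩ := h1.exists
    rw [hb] at hy
    exact lt_irrefl _ hy
  have e : klRisk p vx vy μ (bayesRule p vx vy π)
      = ∫⁻ x, klLoss p vy μ (bayesRule p vx vy π x) ∂(nm p vx μ) := by
    rw [nm_lintegral]; unfold klRisk; simp_rw [mul_comm]
  have := nm_prob hvx μ
  rw [e] at hR
  simp_rw [hl] at hR
  simp at hR

lemma marg_one {v : ℝ} (hv : 0 < v) (z : EuclideanSpace ℝ (Fin p)) :
    marg p v (fun _ => 1) z = 1 := by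
  unfold marg
  simp_rw [mul_one, fun θ => gauss_symm v θ z]
  exact gauss_integral hv z

end PartD5

/-- **Theorem 1** (Brown–George–Xu): the KL risk difference between the Bayes rules under the
uniform prior and under `π` is an integral of quadratic risk differences. -/
theorem kl_risk_difference_eq_integral_quadratic_risk_difference
    (p : ℕ) (vx vy : ℝ) (hvx : 0 < vx) (hvy : 0 < vy)
    (π : EuclideanSpace ℝ (Fin p) → ℝ) (hπ : ∀ μ, 0 ≤ π μ)
    (hm : ∀ z, Integrable (fun μ => gauss p vx μ z * π μ))
    (hR : ∀ μ, klRisk p vx vy μ (bayesRule p vx vy π) < ⊤)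
    (μ : EuclideanSpace ℝ (Fin p)) :
    (klRisk p vx vy μ (bayesRule p vx vy fun _ => 1)).toReal
        - (klRisk p vx vy μ (bayesRule p vx vy π)).toReal
      = (1 / 2) * ∫ v in (vx * vy / (vx + vy))..vx,
          (1 / v ^ 2) * (qRisk p v μ (fun z => z) - qRisk p v μ (postMean p v π)) := by
  have hs : 0 < vx + vy := by linarith
  have hvw : 0 < vx * vy / (vx + vy) := by positivity
  have hlt : vx * vy / (vx + vy) < vx := by
    rw [div_lt_iff₀ hs]; nlinarith
  have hne := prior_ne_zero hvx μ (hR μ)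
  obtain ⟨hli, h1⟩ := klRisk_rep hvx hvy hπ hm hne μ (Or.inl (hR μ))
  have hm1 : ∀ z : EuclideanSpace ℝ (Fin p),
      Integrable (fun θ => gauss p vx θ z * (fun _ : EuclideanSpace ℝ (Fin p) => (1 : ℝ)) θ) := by
    intro z
    simp_rw [mul_one, fun θ => gauss_symm vx θ z]
    exact gauss_integrable hvx z
  have hne1 : ¬ (fun _ : EuclideanSpace ℝ (Fin p) => (1 : ℝ)) =ᵐ[volume] 0 := by
    intro h
    obtain ⟨y, hy⟩ := h.exists
    simp at hy
  have hl1 : Integrable (fun z => Real.log (marg p vx (fun _ => 1) z)) (nm p vx μ) := by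
    simp_rw [marg_one hvx, Real.log_one]
    exact integrable_zero _ _ _
  obtain ⟨-, h2⟩ := klRisk_rep hvx hvy (fun _ => zero_le_one) hm1 hne1 μ (Or.inr hl1)
  simp_rw [marg_one hvx, marg_one hvw, Real.log_one, integral_zero] at h2
  rw [h2, h1, ← analytic hvx hπ hm hne μ hvw hlt hli]
  ring
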